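/- Let 1 ≤ p < ∞ and ν > n/2 − 1. Then for every 1 ≤ q < ∞ and μ > n/2 − 1, the subspace A^p_ν ∩ A^q_μ is dense in A^p_ν in the L^p_ν norm; moreover A^p_ν ∩ H^∞(T_Λ) is dense in A^p_ν, where H^∞(T_Λ) denotes the bounded holomorphic functions on T_Λ. -/

import Mathlib

open MeasureTheory Complex Set
open scoped ENNReal

noncomputable section

/-- The Lorentz form `Δ(y) = y₁² − y₂² − ⋯ − yₙ²` on `ℝⁿ`
(written as `2 y₀² − ∑ yᵢ²` with 0-based indexing). -/
def lor {n : ℕ} [NeZero n] (y : Fin n → ℝ) : ℝ := 2 * y 0 ^ 2 - ∑ i, y i ^ 2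

/-- The holomorphic extension of the Lorentz form to `ℂⁿ`. -/
def lorC {n : ℕ} [NeZero n] (z : Fin n → ℂ) : ℂ := 2 * z 0 ^ 2 - ∑ i, z i ^ 2

/-- Componentwise imaginary part. -/
def imP {n : ℕ} (z : Fin n → ℂ) : Fin n → ℝ := fun i => (z i).im

/-- The forward light cone `Λ`. -/
def cone (n : ℕ) [NeZero n] : Set (Fin n → ℝ) := {y | 0 < lor y ∧ 0 < y 0}

/-- The tube domain `T_Λ` over the forward light cone. -/
def tube (n : ℕ) [NeZero n] : Set (Fin n → ℂ) := {z | imP z ∈ cone n}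

/-- The weighted measure `dV_ν = Δ(Im z)^{ν − n/2} dz` on `T_Λ`. -/
def dV (n : ℕ) [NeZero n] (ν : ℝ) : Measure (Fin n → ℂ) :=
  ((volume : Measure (Fin n → ℂ)).restrict (tube n)).withDensity
    (fun z => ENNReal.ofReal (lor (imP z) ^ (ν - (n : ℝ) / 2)))

/-- `∫ |F|^p dV_ν` (as an extended nonnegative real). -/
def lpInt (n : ℕ) [NeZero n] (p ν : ℝ) (F : (Fin n → ℂ) → ℂ) : ℝ≥0∞ :=
  ∫⁻ z, ENNReal.ofReal (‖F z‖ ^ p) ∂(dV n ν)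

/-- The `L^p_ν` norm `(∫ |F|^p dV_ν)^{1/p}`. -/
def lpNorm (n : ℕ) [NeZero n] (p ν : ℝ) (F : (Fin n → ℂ) → ℂ) : ℝ≥0∞ :=
  (lpInt n p ν F) ^ (1 / p)

/-- The Bergman space `A^p_ν`: holomorphic on `T_Λ` and in `L^p_ν`. -/
def memA (n : ℕ) [NeZero n] (p ν : ℝ) (F : (Fin n → ℂ) → ℂ) : Prop :=
  DifferentiableOn ℂ F (tube n) ∧ lpInt n p ν F < ⊤

/-- Partial derivative `∂/∂zᵢ`. -/
def pd {n : ℕ} (i : Fin n) (F : (Fin n → ℂ) → ℂ) : (Fin n → ℂ) → ℂ :=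
  fun z => fderiv ℂ F z (Pi.single i 1)

/-- The wave (Box) operator `□ = −(∂₁² − ∂₂² − ⋯ − ∂ₙ²)`, so that
`□ e^{i z·ξ} = Δ(ξ) e^{i z·ξ}`. -/
def BoxOp {n : ℕ} [NeZero n] (F : (Fin n → ℂ) → ℂ) : (Fin n → ℂ) → ℂ :=
  fun z => -(2 * pd 0 (pd 0 F) z - ∑ i, pd i (pd i F) z)

/-- The (unnormalized) Bergman kernel `B_β(z,w) = Δ((z − w̄)/i)^{−(β+n)}`. -/
def berg (n : ℕ) [NeZero n] (β : ℝ) (z w : Fin n → ℂ) : ℂ :=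
  lorC (fun i => (z i - (starRingEnd ℂ) (w i)) / Complex.I) ^ (-(β + (n : ℝ)) : ℂ)

/-- The Hardy inequality holds for `(p, ν)`:
`∫ |F|^p dV_ν ≤ C ∫ |Δ(Im z) □F(z)|^p dV_ν(z)` for all `F ∈ A^p_ν`. -/
def hardy (n : ℕ) [NeZero n] (p ν : ℝ) : Prop :=
  ∃ C > (0 : ℝ), ∀ F, memA n p ν F →
    lpInt n p ν F ≤ ENNReal.ofReal C *
      lpInt n p ν (fun z => (lor (imP z) : ℂ) * BoxOp F z)

/-- `g` is the orthogonal projection of `f ∈ L²_ν` onto the closed subspace `A²_ν`: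
`g ∈ A²_ν` and `f − g ⊥ A²_ν`. -/
def isProj (n : ℕ) [NeZero n] (ν : ℝ) (f g : (Fin n → ℂ) → ℂ) : Prop :=
  memA n 2 ν g ∧ ∀ h, memA n 2 ν h →
    ∫ z, f z * (starRingEnd ℂ) (h z) ∂(dV n ν) =
      ∫ z, g z * (starRingEnd ℂ) (h z) ∂(dV n ν)

/-- The Bergman projection `P_ν` admits a bounded extension to `L^p_ν`:
`‖P_ν f‖_{L^p_ν} ≤ C ‖f‖_{L^p_ν}` for all `f ∈ L²_ν ∩ L^p_ν`. -/
def projBounded (n : ℕ) [NeZero n] (p ν : ℝ) : Prop :=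
  ∃ C > (0 : ℝ), ∀ f g : (Fin n → ℂ) → ℂ,
    AEStronglyMeasurable f (dV n ν) → lpInt n 2 ν f < ⊤ → lpInt n p ν f < ⊤ →
    isProj n ν f g → lpNorm n p ν g ≤ ENNReal.ofReal C * lpNorm n p ν f

/-- A bounded (continuous) linear functional on `A^p_ν`. -/
def isBddFunc (n : ℕ) [NeZero n] (p ν : ℝ) (γ : ((Fin n → ℂ) → ℂ) → ℂ) : Prop :=
  (∀ F G, memA n p ν F → memA n p ν G → γ (F + G) = γ F + γ G) ∧
  (∀ (c : ℂ) (F), memA n p ν F → γ (fun z => c * F z) = c * γ F) ∧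
  ∃ C : ℝ, ∀ F, memA n p ν F → ‖γ F‖ ≤ C * (lpNorm n p ν F).toReal

open Filter Topology Metric

theorem enorm_rpow_le_circle {g : ℂ → ℂ} (hg : DiffContOnCl ℂ g (ball 0 1)) {p : ℝ} (hp : 1 ≤ p) :
    ENNReal.ofReal (2 * Real.pi) * ‖g 0‖ₑ ^ p ≤
      ∫⁻ θ in Ioc 0 (2 * Real.pi), ‖g (exp (θ * I))‖ₑ ^ p := by
  have hpi : 0 < 2 * Real.pi := by positivity
  set c : ℝ≥0∞ := ENNReal.ofReal (2 * Real.pi) with hc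
  have hc0 : c ≠ 0 := by simpa [hc] using Real.pi_pos
  have hct : c ≠ ⊤ := ENNReal.ofReal_ne_top
  let P : Measure ℝ := c⁻¹ • volume.restrict (Ioc 0 (2 * Real.pi))
  have : IsProbabilityMeasure P := ⟨by
    simp only [P, Measure.smul_apply, Measure.restrict_apply_univ, Real.volume_Ioc,
      sub_zero, smul_eq_mul, ← hc]
    exact ENNReal.inv_mul_cancel hc0 hct⟩
  have hcont : Continuous fun θ : ℝ => g (exp (θ * I)) := by
    have h1 : ContinuousOn g (closedBall 0 1) := by
      simpa [closure_ball (0 : ℂ) one_ne_zero] using hg.2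
    refine h1.comp_continuous (by fun_prop) fun θ => ?_
    simp
  have hmean : g 0 = ∫ θ, g (exp (θ * I)) ∂P := by
    have h := DiffContOnCl.circleAverage (R := 1) (c := 0) (f := g) (by simpa using hg)
    rw [Real.circleAverage_def, intervalIntegral.integral_of_le hpi.le] at h
    rw [← h]
    simp only [P, integral_smul_measure, circleMap, ofReal_one, zero_add, one_mul]
    congr 1
    rw [hc, ENNReal.toReal_inv, ENNReal.toReal_ofReal hpi.le]
  have h1 : ‖g 0‖ₑ ≤ ∫⁻ θ, ‖g (exp (θ * I))‖ₑ ∂P := by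
    conv_lhs => rw [hmean]
    exact enorm_integral_le_lintegral_enorm _
  have h2 := eLpNorm'_le_eLpNorm'_of_exponent_le (μ := P) one_pos hp hcont.aestronglyMeasurable
  have hp0 : 0 < p := by linarith
  have h3 : ‖g 0‖ₑ ^ p ≤ ∫⁻ θ, ‖g (exp (θ * I))‖ₑ ^ p ∂P := by
    rw [lintegral_rpow_enorm_eq_rpow_eLpNorm' hp0]
    refine ENNReal.rpow_le_rpow (h1.trans (le_trans (le_of_eq ?_) h2)) hp0.le
    simp [eLpNorm'_eq_lintegral_enorm]
  calc c * ‖g 0‖ₑ ^ p ≤ c * ∫⁻ θ, ‖g (exp (θ * I))‖ₑ ^ p ∂P := by gcongr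
    _ = _ := by
      simp only [P, lintegral_smul_measure, smul_eq_mul]
      rw [← mul_assoc, ENNReal.mul_inv_cancel hc0 hct, one_mul]

theorem enorm_rpow_mul_measure_ball_le {E : Type*} [NormedAddCommGroup E] [NormedSpace ℂ E]
    [MeasurableSpace E] [BorelSpace E] [SecondCountableTopology E] (μ : Measure E) [SFinite μ]
    (hμ : ∀ θ : ℝ, MeasurePreserving (fun v : E => exp ((θ : ℝ) * I) • v) μ μ) {f : E → ℂ} {r : ℝ}
    (hf : DifferentiableOn ℂ f (ball 0 r)) {p : ℝ} (hp : 1 ≤ p) :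
    ‖f 0‖ₑ ^ p * μ (ball 0 r) ≤ ∫⁻ v in ball 0 r, ‖f v‖ₑ ^ p ∂μ := by
  set c : ℝ≥0∞ := ENNReal.ofReal (2 * Real.pi) with hc
  have hc0 : c ≠ 0 := by simpa [hc] using Real.pi_pos
  have hct : c ≠ ⊤ := ENNReal.ofReal_ne_top
  let k : E → ℝ≥0∞ := (ball 0 r).indicator fun v => ‖f v‖ₑ ^ p
  have hk : Measurable k := by
    have : Measurable ((ball 0 r).indicator f) := by
      classical
      rw [← piecewise_eq_indicator]
      exact hf.continuousOn.measurable_piecewise continuousOn_const measurableSet_ball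
    have h2 : k = fun v => ‖(ball 0 r).indicator f v‖ₑ ^ p := by
      ext v
      by_cases hv : v ∈ ball (0 : E) r
      · simp [k, hv]
      · simp [k, hv, ENNReal.zero_rpow_of_pos (show 0 < p by linarith)]
    rw [h2]
    fun_prop
  have hpt : ∀ v ∈ ball (0 : E) r, c * ‖f 0‖ₑ ^ p ≤
      ∫⁻ θ in Ioc (0 : ℝ) (2 * Real.pi), k (exp ((θ : ℝ) * I) • v) := by
    intro v hv
    have hmem : ∀ w ∈ closedBall (0 : ℂ) 1, w • v ∈ ball (0 : E) r := by
      intro w hw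
      rw [mem_ball_zero_iff] at hv ⊢
      rw [mem_closedBall_zero_iff] at hw
      rw [norm_smul]
      nlinarith [norm_nonneg v]
    have hd : DifferentiableOn ℂ (fun w : ℂ => f (w • v)) (closedBall 0 1) :=
      hf.comp (by fun_prop) hmem
    have := enorm_rpow_le_circle (g := fun w => f (w • v))
      (hd.diffContOnCl_ball le_rfl) hp
    simp only [zero_smul] at this
    refine this.trans (le_of_eq ?_)
    refine lintegral_congr fun θ => ?_
    have : exp ((θ : ℝ) * I) • v ∈ ball (0 : E) r :=
      hmem _ (by simp [norm_exp_ofReal_mul_I])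
    simp [k, this]
  have hinv : ∀ θ : ℝ, ∫⁻ v in ball 0 r, k (exp (θ * I) • v) ∂μ = ∫⁻ v, k v ∂μ := by
    intro θ
    rw [← (hμ θ).lintegral_comp hk, ← lintegral_indicator measurableSet_ball]
    refine lintegral_congr fun v => ?_
    by_cases hv : v ∈ ball (0 : E) r
    · simp [hv]
    · have : exp (θ * I) • v ∉ ball (0 : E) r := by
        simpa [norm_smul, norm_exp_ofReal_mul_I] using hv
      simp [hv, k, this]
  have key : c * (‖f 0‖ₑ ^ p * μ (ball 0 r)) ≤ c * ∫⁻ v in ball 0 r, ‖f v‖ₑ ^ p ∂μ := by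
    calc c * (‖f 0‖ₑ ^ p * μ (ball 0 r)) = ∫⁻ v in ball 0 r, c * ‖f 0‖ₑ ^ p ∂μ := by
          simp [mul_assoc]
      _ ≤ ∫⁻ v in ball 0 r, (∫⁻ θ in Ioc (0 : ℝ) (2 * Real.pi), k (exp ((θ : ℝ) * I) • v)) ∂μ :=
          setLIntegral_mono' measurableSet_ball hpt
      _ = ∫⁻ θ in Ioc (0 : ℝ) (2 * Real.pi), ∫⁻ v in ball 0 r, k (exp ((θ : ℝ) * I) • v) ∂μ := by
          refine lintegral_lintegral_swap ?_
          refine (hk.comp ?_).aemeasurable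
          exact Continuous.measurable (by fun_prop)
      _ = ∫⁻ θ in Ioc (0 : ℝ) (2 * Real.pi), ∫⁻ v, k v ∂μ := by simp_rw [hinv]
      _ = c * ∫⁻ v in ball 0 r, ‖f v‖ₑ ^ p ∂μ := by
          rw [lintegral_const, ← lintegral_indicator measurableSet_ball]
          simp [k, hc, mul_comm]
  exact (ENNReal.mul_le_mul_iff_right hc0 hct).1 key

theorem measurePreserving_exp_smul (θ : ℝ) :
    MeasurePreserving (fun w : ℂ => exp (θ * I) • w) volume volume := by
  have := (rotation (Circle.exp θ)).measurePreserving
  convert! this using 2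

theorem measurePreserving_exp_smul_pi {n : ℕ} (θ : ℝ) :
    MeasurePreserving (fun w : Fin n → ℂ => exp (θ * I) • w) volume volume :=
  volume_preserving_pi (fun _ : Fin n => measurePreserving_exp_smul θ)

/-- The power `t ^ α` on the positive half-line, extended by zero. -/
def posPow (α t : ℝ) : ℝ≥0∞ := (Ioi 0).indicator (fun t : ℝ => ENNReal.ofReal (t ^ α)) t

theorem posPow_of_pos {α t : ℝ} (ht : 0 < t) : posPow α t = ENNReal.ofReal (t ^ α) := by
  simp [posPow, ht]

theorem posPow_of_nonpos {α t : ℝ} (ht : t ≤ 0) : posPow α t = 0 := by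
  simp [posPow, ht]

theorem measurable_posPow (α : ℝ) : Measurable (posPow α) :=
  Measurable.indicator (by fun_prop) measurableSet_Ioi

theorem posPow_mul {α c : ℝ} (hc : 0 < c) (t : ℝ) :
    posPow α (c * t) = ENNReal.ofReal (c ^ α) * posPow α t := by
  rcases le_or_gt t 0 with ht | ht
  · rw [posPow_of_nonpos ht, posPow_of_nonpos (mul_nonpos_of_nonneg_of_nonpos hc.le ht), mul_zero]
  · rw [posPow_of_pos ht, posPow_of_pos (mul_pos hc ht), Real.mul_rpow hc.le ht.le,
      ENNReal.ofReal_mul (by positivity)]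

theorem lintegral_posPow_Iio {α : ℝ} (hα : -1 < α) {s : ℝ} (hs : 0 < s) :
    ∫⁻ t in Iio s, posPow α t = ENNReal.ofReal (s ^ (α + 1) / (α + 1)) := by
  have h1 : ∫⁻ t in Iio s, posPow α t = ∫⁻ t in Ioo 0 s, ENNReal.ofReal (t ^ α) := by
    simp only [posPow]
    rw [lintegral_indicator measurableSet_Ioi, Measure.restrict_restrict measurableSet_Ioi]
    rfl
  have hint : IntegrableOn (fun t : ℝ => t ^ α) (Ioo 0 s) :=
    (intervalIntegral.integrableOn_Ioo_rpow_iff hs).2 hα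
  rw [h1, ← ofReal_integral_eq_lintegral_ofReal hint]
  · rw [← integral_Ioc_eq_integral_Ioo, ← intervalIntegral.integral_of_le hs.le,
      integral_rpow (Or.inl hα), Real.zero_rpow (by linarith), sub_zero]
  · filter_upwards [self_mem_ae_restrict measurableSet_Ioo] with t ht
    exact Real.rpow_nonneg ht.1.le _

theorem lintegral_posPow_sub_le {α : ℝ} (hα : -1 < α) (hα0 : α ≤ 0) (s : ℝ) :
    ∫⁻ t in Ioo 0 1, posPow α (s - t) ≤ 1 + ENNReal.ofReal (1 / (α + 1)) := by
  have hle : ∀ t, posPow α t ≤ 1 + (Iio 1).indicator (posPow α) t := by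
    intro t
    rcases lt_or_ge t 1 with h | h
    · simp [h]
    · rw [posPow_of_pos (by linarith)]
      refine le_add_right ?_
      rw [← ENNReal.ofReal_one]
      exact ENNReal.ofReal_le_ofReal (Real.rpow_le_one_of_one_le_of_nonpos h hα0)
  calc ∫⁻ t in Ioo 0 1, posPow α (s - t)
      ≤ ∫⁻ t in Ioo 0 1, (1 + (Iio 1).indicator (posPow α) (s - t)) :=
        lintegral_mono fun t => hle _
    _ = (∫⁻ t in Ioo (0 : ℝ) 1, (1 : ℝ≥0∞)) +
        ∫⁻ t in Ioo 0 1, (Iio 1).indicator (posPow α) (s - t) :=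
        lintegral_add_left measurable_const _
    _ ≤ 1 + ∫⁻ t, (Iio 1).indicator (posPow α) (s - t) := by
        gcongr
        · simp
        · exact Measure.restrict_le_self
    _ = 1 + ENNReal.ofReal (1 / (α + 1)) := by
        rw [lintegral_sub_left_eq_self (fun t => (Iio 1).indicator (posPow α) t),
          lintegral_indicator measurableSet_Iio, lintegral_posPow_Iio hα one_pos, Real.one_rpow]

theorem abs_im_lt_of_mem_ball {ζ : ℂ} (h : ζ ∈ ball (0 : ℂ) (1 / 2)) : |ζ.im| < 1 / 2 :=
  (Complex.abs_im_le_norm ζ).trans_lt (by simpa using h)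

theorem lintegral_ball_comp_im_le {f : ℝ → ℝ≥0∞} (hf : Measurable f) :
    ∫⁻ ζ in ball (0 : ℂ) (1 / 2), f ζ.im ≤ ∫⁻ t in Ioo (-(1 / 2) : ℝ) (1 / 2), f t := by
  calc ∫⁻ ζ in ball (0 : ℂ) (1 / 2), f ζ.im
      ≤ ∫⁻ ζ : ℂ, (Ioo (-(1 / 2) : ℝ) (1 / 2)).indicator 1 ζ.re *
          (Ioo (-(1 / 2) : ℝ) (1 / 2)).indicator f ζ.im := by
        rw [← lintegral_indicator measurableSet_ball]
        refine lintegral_mono fun ζ => ?_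
        by_cases h : ζ ∈ ball (0 : ℂ) (1 / 2)
        · have h1 := abs_lt.1 (abs_im_lt_of_mem_ball h)
          have h2 := abs_lt.1 ((Complex.abs_re_le_norm ζ).trans_lt (mem_ball_zero_iff.1 h))
          rw [indicator_of_mem h, indicator_of_mem (show ζ.re ∈ _ from h2),
            indicator_of_mem (show ζ.im ∈ _ from h1)]
          simp
        · rw [indicator_of_notMem h]
          exact zero_le
    _ = ∫⁻ x : ℝ × ℝ, (Ioo (-(1 / 2) : ℝ) (1 / 2)).indicator 1 x.1 *
          (Ioo (-(1 / 2) : ℝ) (1 / 2)).indicator f x.2 := by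
        rw [← Complex.volume_preserving_equiv_real_prod.lintegral_comp_emb
          measurableEquivRealProd.measurableEmbedding]
        rfl
    _ = _ := by
        rw [Measure.volume_eq_prod, lintegral_prod_mul
          ((measurable_one.indicator measurableSet_Ioo).aemeasurable)
          ((hf.indicator measurableSet_Ioo).aemeasurable),
          lintegral_indicator measurableSet_Ioo, lintegral_indicator measurableSet_Ioo, Pi.one_def,
          setLIntegral_const]
        norm_num

theorem exists_lintegral_ball_posPow_le {α : ℝ} (hα : -1 < α) :
    ∃ C : ℝ≥0∞, C ≠ ⊤ ∧ ∀ s > 0,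
      ∫⁻ ζ in ball (0 : ℂ) (1 / 2), posPow α (s - (1 + ζ.im)) ≤ C * posPow α s := by
  set V : ℝ≥0∞ := volume (ball (0 : ℂ) (1 / 2)) with hV
  have hVt : V ≠ ⊤ := measure_ball_lt_top.ne
  refine ⟨V * (1 + ENNReal.ofReal (2 ^ (-α))) + ENNReal.ofReal (3 / (α + 1)), by finiteness, ?_⟩
  intro s hs
  have hconst : ∀ c : ℝ≥0∞, (∀ ζ ∈ ball (0 : ℂ) (1 / 2),
      posPow α (s - (1 + ζ.im)) ≤ c * posPow α s) →
      ∫⁻ ζ in ball (0 : ℂ) (1 / 2), posPow α (s - (1 + ζ.im)) ≤ V * c * posPow α s := by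
    intro c hc
    refine (setLIntegral_mono' measurableSet_ball hc).trans (le_of_eq ?_)
    rw [setLIntegral_const, ← hV]
    ring
  rcases le_or_gt 0 α with h0 | h0
  · refine (hconst 1 fun ζ hζ => ?_).trans ?_
    · have h1 := abs_lt.1 (abs_im_lt_of_mem_ball hζ)
      rcases le_or_gt (s - (1 + ζ.im)) 0 with h | h
      · simp [posPow_of_nonpos h]
      · rw [posPow_of_pos h, posPow_of_pos hs, one_mul]
        exact ENNReal.ofReal_le_ofReal (Real.rpow_le_rpow h.le (by linarith) h0)
    · gcongr
      exact le_add_right (by gcongr; exact le_self_add)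
  rcases le_or_gt 3 s with h3 | h3
  · refine (hconst (ENNReal.ofReal (2 ^ (-α))) fun ζ hζ => ?_).trans ?_
    · have h1 := abs_lt.1 (abs_im_lt_of_mem_ball hζ)
      have h2 : s / 2 ≤ s - (1 + ζ.im) := by linarith
      rw [posPow_of_pos (by linarith), posPow_of_pos hs, ← ENNReal.ofReal_mul (by positivity)]
      refine ENNReal.ofReal_le_ofReal
        ((Real.rpow_le_rpow_of_nonpos (by linarith) h2 h0.le).trans (le_of_eq ?_))
      rw [Real.div_rpow hs.le (by norm_num), Real.rpow_neg (by norm_num)]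
      field_simp
    · gcongr
      exact le_add_right (by gcongr; exact le_add_self)
  · have hm : Measurable fun t : ℝ => posPow α (s - (1 + t)) :=
      (measurable_posPow α).comp (by fun_prop)
    have hm' : Measurable ((Iio s).indicator (posPow α)) :=
      (measurable_posPow α).indicator measurableSet_Iio
    calc ∫⁻ ζ in ball (0 : ℂ) (1 / 2), posPow α (s - (1 + ζ.im))
        ≤ ∫⁻ t in Ioo (-(1 / 2) : ℝ) (1 / 2), posPow α (s - (1 + t)) :=
          lintegral_ball_comp_im_le hm
      _ ≤ ∫⁻ t in Ioo (-(1 / 2) : ℝ) (1 / 2), (Iio s).indicator (posPow α) (s - (1 + t)) := by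
          refine setLIntegral_mono' measurableSet_Ioo fun t ht => ?_
          rw [indicator_of_mem]
          simp only [mem_Iio]
          linarith [ht.1]
      _ ≤ ∫⁻ t, (Iio s).indicator (posPow α) (s - (1 + t)) :=
          lintegral_mono' Measure.restrict_le_self le_rfl
      _ = ∫⁻ t in Iio s, posPow α t := by
          rw [lintegral_add_left_eq_self (fun t => (Iio s).indicator (posPow α) (s - t)),
            lintegral_sub_left_eq_self (fun t => (Iio s).indicator (posPow α) t),
            lintegral_indicator measurableSet_Iio]
      _ = ENNReal.ofReal (s ^ (α + 1) / (α + 1)) := lintegral_posPow_Iio hα hs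
      _ ≤ ENNReal.ofReal (3 / (α + 1)) * posPow α s := by
          rw [posPow_of_pos hs, ← ENNReal.ofReal_mul (div_nonneg (by norm_num) (by linarith))]
          refine ENNReal.ofReal_le_ofReal ?_
          rw [Real.rpow_add_one hs.ne']
          have : 0 < α + 1 := by linarith
          rw [div_mul_eq_mul_div]
          refine div_le_div_of_nonneg_right ?_ this.le
          nlinarith [Real.rpow_pos_of_pos hs α]
      _ ≤ _ := by
          gcongr
          exact le_add_self

theorem continuous_imP {n : ℕ} : Continuous (imP : (Fin n → ℂ) → Fin n → ℝ) := by
  unfold imP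
  fun_prop

variable {n : ℕ} [NeZero n]

/-- The polarization of the Lorentz form, normalized so that `lor (y + u)` equals
`lor y + lorBil y u + lor u`. -/
def lorBil (y u : Fin n → ℝ) : ℝ := 2 * (2 * (y 0 * u 0) - ∑ i, y i * u i)

theorem lor_add (y u : Fin n → ℝ) : lor (y + u) = lor y + lorBil y u + lor u := by
  have : ∑ i, (y i + u i) ^ 2 = ∑ i, y i ^ 2 + 2 * ∑ i, y i * u i + ∑ i, u i ^ 2 := by
    rw [Finset.mul_sum, ← Finset.sum_add_distrib, ← Finset.sum_add_distrib]
    exact Finset.sum_congr rfl fun i _ => by ring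
  simp only [lor, lorBil, Pi.add_apply, this]
  ring

theorem lor_smul (t : ℝ) (u : Fin n → ℝ) : lor (t • u) = t ^ 2 * lor u := by
  simp only [lor, Pi.smul_apply, smul_eq_mul, mul_pow, ← Finset.mul_sum]
  ring

theorem lorBil_smul_right (t : ℝ) (y u : Fin n → ℝ) : lorBil y (t • u) = t * lorBil y u := by
  simp only [lorBil, Pi.smul_apply, smul_eq_mul, mul_left_comm _ t, ← Finset.mul_sum]
  ring

theorem lorBil_sub_smul_left (t : ℝ) (y v u : Fin n → ℝ) :
    lorBil (y - t • v) u = lorBil y u - t * lorBil v u := by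
  have : ∑ i, (y i - t * v i) * u i = ∑ i, y i * u i - t * ∑ i, v i * u i := by
    rw [Finset.mul_sum, ← Finset.sum_sub_distrib]
    exact Finset.sum_congr rfl fun i _ => by ring
  simp only [lorBil, Pi.smul_apply, smul_eq_mul, Pi.sub_apply, this]
  ring

theorem lor_eq (y : Fin n → ℝ) : lor y = y 0 ^ 2 - ∑ i ∈ Finset.univ.erase 0, y i ^ 2 := by
  rw [lor, ← Finset.add_sum_erase _ _ (Finset.mem_univ (0 : Fin n))]
  ring

theorem lorBil_pos {y u : Fin n → ℝ} (hy : y ∈ cone n) (hu : 0 ≤ lor u) (hu0 : 0 < u 0) :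
    0 < lorBil y u := by
  have hy1 := hy.1
  have hy2 := hy.2
  rw [lor_eq] at hy1 hu
  have hcs := Finset.sum_mul_sq_le_sq_mul_sq (Finset.univ.erase (0 : Fin n)) y u
  have h : (∑ i ∈ Finset.univ.erase 0, y i * u i) ^ 2 < (y 0 * u 0) ^ 2 := by
    refine hcs.trans_lt ?_
    rw [mul_pow]
    calc _ ≤ (∑ i ∈ Finset.univ.erase 0, y i ^ 2) * u 0 ^ 2 := by
          gcongr
          linarith
      _ < _ := by
          gcongr
          linarith
  have := (abs_lt_of_sq_lt_sq' h (by positivity)).2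
  rw [lorBil, ← Finset.add_sum_erase _ _ (Finset.mem_univ (0 : Fin n))]
  linarith

theorem lor_le_lor_add {y u : Fin n → ℝ} (hy : y ∈ cone n) (hu : 0 ≤ lor u) (hu0 : 0 < u 0) :
    lor y + lor u ≤ lor (y + u) := by
  rw [lor_add]
  linarith [lorBil_pos hy hu hu0]

theorem add_mem_cone {y u : Fin n → ℝ} (hy : y ∈ cone n) (hu : 0 ≤ lor u) (hu0 : 0 < u 0) :
    y + u ∈ cone n :=
  ⟨by linarith [lor_le_lor_add hy hu hu0, hy.1], by
    have := hy.2
    simp only [Pi.add_apply]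
    linarith⟩

theorem lor_le_sq (y : Fin n → ℝ) : lor y ≤ y 0 ^ 2 := by
  rw [lor_eq]
  linarith [Finset.sum_nonneg fun i (_ : i ∈ Finset.univ.erase (0 : Fin n)) => sq_nonneg (y i)]

theorem abs_lt_of_mem_cone {y : Fin n → ℝ} (hy : y ∈ cone n) {i : Fin n} (hi : i ≠ 0) :
    |y i| < y 0 := by
  have h1 := hy.1
  rw [lor_eq] at h1
  have h2 : y i ^ 2 ≤ ∑ i ∈ Finset.univ.erase 0, y i ^ 2 :=
    Finset.single_le_sum (f := fun i => y i ^ 2) (fun i _ => sq_nonneg _) (by simp [hi])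
  exact abs_lt_of_sq_lt_sq (by linarith) hy.2.le

theorem continuous_lor : Continuous (lor : (Fin n → ℝ) → ℝ) := by
  unfold lor
  fun_prop

theorem isOpen_cone : IsOpen (cone n) :=
  (isOpen_lt continuous_const continuous_lor).inter
    (isOpen_lt continuous_const (continuous_apply 0))

theorem isOpen_tube : IsOpen (tube n) := isOpen_cone.preimage continuous_imP

/-- The power `lor y ^ α` on the light cone, extended by zero. -/
def coneWeight (α : ℝ) (y : Fin n → ℝ) : ℝ≥0∞ :=
  (cone n).indicator (fun y => ENNReal.ofReal (lor y ^ α)) y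

theorem coneWeight_of_mem {α : ℝ} {y : Fin n → ℝ} (hy : y ∈ cone n) :
    coneWeight α y = ENNReal.ofReal (lor y ^ α) := by simp [coneWeight, hy]

theorem coneWeight_of_notMem {α : ℝ} {y : Fin n → ℝ} (hy : y ∉ cone n) :
    coneWeight α y = 0 := by simp [coneWeight, hy]

theorem measurable_coneWeight (α : ℝ) : Measurable (coneWeight α : (Fin n → ℝ) → ℝ≥0∞) :=
  Measurable.indicator ((continuous_lor.measurable.pow_const α).ennreal_ofReal)
    isOpen_cone.measurableSet

theorem continuousAt_coneWeight (α : ℝ) {y : Fin n → ℝ} (hy : y ∈ cone n) :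
    ContinuousAt (coneWeight α) y := by
  have h1 : ContinuousAt (fun y : Fin n → ℝ => ENNReal.ofReal (lor y ^ α)) y :=
    ENNReal.continuous_ofReal.continuousAt.comp
      (continuous_lor.continuousAt.rpow_const (Or.inl hy.1.ne'))
  refine h1.congr ?_
  filter_upwards [isOpen_cone.mem_nhds hy] with x hx
  rw [coneWeight_of_mem hx]

theorem lintegral_dV (ν : ℝ) (g : (Fin n → ℂ) → ℝ≥0∞) :
    ∫⁻ z, g z ∂(dV n ν) = ∫⁻ z, coneWeight (ν - (n : ℝ) / 2) (imP z) * g z := by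
  have hm : Measurable fun z : Fin n → ℂ => ENNReal.ofReal (lor (imP z) ^ (ν - (n : ℝ) / 2)) :=
    (((continuous_lor.comp continuous_imP).measurable).pow_const _).ennreal_ofReal
  rw [dV, lintegral_withDensity_eq_lintegral_mul_non_measurable _ hm (by simp),
    ← lintegral_indicator isOpen_tube.measurableSet]
  refine lintegral_congr fun z => ?_
  by_cases hz : z ∈ tube n
  · rw [indicator_of_mem hz, coneWeight_of_mem hz]
    rfl
  · rw [indicator_of_notMem hz, coneWeight_of_notMem hz, zero_mul]

theorem ofReal_norm_rpow {p : ℝ} (hp : 0 ≤ p) (w : ℂ) :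
    ENNReal.ofReal (‖w‖ ^ p) = ‖w‖ₑ ^ p := by
  rw [← ENNReal.ofReal_rpow_of_nonneg (norm_nonneg w) hp, ofReal_norm]

theorem lpInt_eq {p : ℝ} (hp : 0 ≤ p) (ν : ℝ) (F : (Fin n → ℂ) → ℂ) :
    lpInt n p ν F = ∫⁻ z, coneWeight (ν - (n : ℝ) / 2) (imP z) * ‖F z‖ₑ ^ p := by
  rw [lpInt, lintegral_dV]
  simp_rw [ofReal_norm_rpow hp]

theorem imP_sub_smul {n : ℕ} (z : Fin n → ℂ) (w : ℂ) (u : Fin n → ℝ) :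
    imP (z - w • fun i => (u i : ℂ)) = imP z - w.im • u := by
  ext i
  simp [imP]


theorem coneWeight_sub_le (α t : ℝ) {y u : Fin n → ℝ} (hu : lor u = 0) :
    coneWeight α (y - t • u) ≤ posPow α (lor y - t * lorBil y u) := by
  by_cases h : y - t • u ∈ cone n
  · have h1 : lor (y - t • u) = lor y - t * lorBil y u := by
      rw [sub_eq_add_neg, ← neg_smul, lor_add, lor_smul, lorBil_smul_right, hu]
      ring
    rw [coneWeight_of_mem h, ← h1, posPow_of_pos h.1]
  · rw [coneWeight_of_notMem h]
    exact zero_le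

theorem coneWeight_sub_eq_zero (α : ℝ) {t : ℝ} (ht : 0 < t) {y u : Fin n → ℝ} (hu : lor u = 0)
    (hu0 : 0 < u 0) (hy : y ∉ cone n) : coneWeight α (y - t • u) = 0 := by
  refine coneWeight_of_notMem fun h => hy ?_
  have := add_mem_cone (u := t • u) h (by rw [lor_smul, hu, mul_zero]) (by simp; positivity)
  simpa using this

theorem exists_lintegral_ball_coneWeight_le (n : ℕ) [NeZero n] {α : ℝ} (hα : -1 < α) :
    ∃ C : ℝ≥0∞, C ≠ ⊤ ∧ ∀ u : Fin n → ℝ, lor u = 0 → 0 < u 0 → ∀ δ > 0, ∀ y : Fin n → ℝ,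
      ∫⁻ ζ in ball (0 : ℂ) (1 / 2), coneWeight α (y - (δ * (1 + ζ.im)) • u) ≤
        C * coneWeight α y := by
  obtain ⟨C, hC, h⟩ := exists_lintegral_ball_posPow_le hα
  refine ⟨C, hC, fun u hu hu0 δ hδ y => ?_⟩
  by_cases hy : y ∈ cone n
  · set κ := lorBil y u with hκ
    have hκ0 : 0 < κ := lorBil_pos hy hu.ge hu0
    have hs : 0 < lor y / (δ * κ) := div_pos hy.1 (by positivity)
    have hpos : 0 < δ * κ := by positivity
    have hpt : ∀ ζ : ℂ, coneWeight α (y - (δ * (1 + ζ.im)) • u) ≤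
        ENNReal.ofReal ((δ * κ) ^ α) * posPow α (lor y / (δ * κ) - (1 + ζ.im)) := by
      intro ζ
      refine (coneWeight_sub_le α _ hu).trans (le_of_eq ?_)
      rw [← posPow_mul hpos, ← hκ]
      congr 1
      field_simp
    calc _ ≤ ∫⁻ ζ in ball (0 : ℂ) (1 / 2),
          ENNReal.ofReal ((δ * κ) ^ α) * posPow α (lor y / (δ * κ) - (1 + ζ.im)) :=
          lintegral_mono fun ζ => hpt ζ
      _ = ENNReal.ofReal ((δ * κ) ^ α) *
          ∫⁻ ζ in ball (0 : ℂ) (1 / 2), posPow α (lor y / (δ * κ) - (1 + ζ.im)) :=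
          lintegral_const_mul' _ _ ENNReal.ofReal_ne_top
      _ ≤ ENNReal.ofReal ((δ * κ) ^ α) * (C * posPow α (lor y / (δ * κ))) := by
          gcongr
          exact h _ hs
      _ = C * coneWeight α y := by
          rw [mul_left_comm, ← posPow_mul hpos, mul_div_cancel₀ _ hpos.ne', posPow_of_pos hy.1,
            coneWeight_of_mem hy]
  · rw [setLIntegral_congr_fun (g := fun _ => 0) measurableSet_ball]
    · simp
    · intro ζ hζ
      have := abs_lt.1 (abs_im_lt_of_mem_ball hζ)
      exact coneWeight_sub_eq_zero α (mul_pos hδ (by linarith)) hu hu0 hy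

theorem lintegral_mul_one_add_norm_le {n : ℕ} {N : ℝ} (hN : 0 ≤ N) {g h : (Fin n → ℝ) → ℝ≥0∞}
    (hg : Measurable g) (v : Fin n → ℝ) (hgh : ∀ y, ∫⁻ t in Ioo (0 : ℝ) 1, g (y - t • v) ≤ h y) :
    ∫⁻ z : Fin n → ℂ, g (imP z) * ENNReal.ofReal ((1 + ‖z‖) ^ (-N)) ≤
      ENNReal.ofReal ((1 + ‖v‖) ^ N) *
        ∫⁻ z : Fin n → ℂ, h (imP z) * ENNReal.ofReal ((1 + ‖z‖) ^ (-N)) := by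
  set vC : Fin n → ℂ := fun i => (v i : ℂ) with hvC
  have hvn : ‖vC‖ = ‖v‖ := by simp [hvC, Pi.norm_def]
  set K := ENNReal.ofReal ((1 + ‖v‖) ^ N) with hK
  have hm : ∀ t ∈ Ioo (0 : ℝ) 1, ∀ z : Fin n → ℂ,
      ENNReal.ofReal ((1 + ‖z - ((t : ℂ) * I) • vC‖) ^ (-N)) ≤
        K * ENNReal.ofReal ((1 + ‖z‖) ^ (-N)) := by
    intro t ht z
    rw [hK, ← ENNReal.ofReal_mul (by positivity)]
    refine ENNReal.ofReal_le_ofReal ?_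
    have h1 : ‖z‖ ≤ ‖z - ((t : ℂ) * I) • vC‖ + ‖v‖ := by
      calc ‖z‖ = ‖(z - ((t : ℂ) * I) • vC) + ((t : ℂ) * I) • vC‖ := by simp
        _ ≤ ‖z - ((t : ℂ) * I) • vC‖ + ‖((t : ℂ) * I) • vC‖ := norm_add_le _ _
        _ ≤ _ := by
          gcongr
          rw [norm_smul, hvn]
          simp only [Complex.norm_mul, norm_real, Complex.norm_I, mul_one, Real.norm_eq_abs,
            abs_of_pos ht.1]
          nlinarith [norm_nonneg v, ht.2]
    have h2 : 1 + ‖z‖ ≤ (1 + ‖v‖) * (1 + ‖z - ((t : ℂ) * I) • vC‖) := by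
      nlinarith [norm_nonneg v, norm_nonneg (z - ((t : ℂ) * I) • vC)]
    have h3 := Real.rpow_le_rpow (by positivity) h2 hN
    rw [Real.mul_rpow (by positivity) (by positivity)] at h3
    rw [Real.rpow_neg (by positivity), Real.rpow_neg (by positivity), ← div_eq_mul_inv,
      inv_eq_one_div, div_le_div_iff₀ (by positivity) (by positivity), one_mul]
    exact h3
  have hgm : Measurable fun q : ℝ × (Fin n → ℂ) =>
      g (imP q.2 - q.1 • v) * (K * ENNReal.ofReal ((1 + ‖q.2‖) ^ (-N))) := by
    have := (continuous_imP (n := n)).measurable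
    have h1 : Measurable fun q : ℝ × (Fin n → ℂ) => g (imP q.2 - q.1 • v) := hg.comp (by fun_prop)
    fun_prop
  set J := ∫⁻ z : Fin n → ℂ, g (imP z) * ENNReal.ofReal ((1 + ‖z‖) ^ (-N)) with hJ
  have htr : ∀ t ∈ Ioo (0 : ℝ) 1, J ≤
      ∫⁻ z : Fin n → ℂ, g (imP z - t • v) * (K * ENNReal.ofReal ((1 + ‖z‖) ^ (-N))) := by
    intro t ht
    rw [hJ, ← lintegral_sub_right_eq_self _ (((t : ℂ) * I) • vC)]
    refine lintegral_mono fun z => ?_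
    rw [imP_sub_smul]
    simp only [mul_im, ofReal_re, I_im, mul_one, ofReal_im, I_re, mul_zero, add_zero]
    gcongr
    exact hm t ht z
  calc J = ∫⁻ t in Ioo (0 : ℝ) 1, J := by simp
    _ ≤ ∫⁻ t in Ioo (0 : ℝ) 1, ∫⁻ z : Fin n → ℂ,
        g (imP z - t • v) * (K * ENNReal.ofReal ((1 + ‖z‖) ^ (-N))) :=
        setLIntegral_mono' measurableSet_Ioo htr
    _ = ∫⁻ z : Fin n → ℂ, ∫⁻ t in Ioo (0 : ℝ) 1,
        g (imP z - t • v) * (K * ENNReal.ofReal ((1 + ‖z‖) ^ (-N))) :=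
        lintegral_lintegral_swap hgm.aemeasurable
    _ ≤ ∫⁻ z : Fin n → ℂ, K * (h (imP z) * ENNReal.ofReal ((1 + ‖z‖) ^ (-N))) := by
        refine lintegral_mono fun z => ?_
        rw [lintegral_mul_const' _ _ (by finiteness), mul_left_comm K]
        gcongr
        exact hgh _
    _ = _ := lintegral_const_mul' _ _ ENNReal.ofReal_ne_top

theorem exists_lightlike (hn : 2 ≤ n) : ∃ u v : Fin n → ℝ, lor u = 0 ∧ 0 < u 0 ∧ lor v = 0 ∧
    0 < v 0 ∧ 0 < lorBil v u := by
  let j : Fin n := ⟨1, hn⟩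
  have hj : j ≠ 0 := fun h => by simpa [j] using congrArg Fin.val h
  have hs : ∀ f : Fin n → ℝ, (∀ i, i ≠ 0 → i ≠ j → f i = 0) → ∑ i, f i = f 0 + f j := by
    intro f hf
    rw [← Finset.sum_subset (Finset.subset_univ {0, j}), Finset.sum_pair hj.symm]
    intro i _ hi
    simp only [Finset.mem_insert, Finset.mem_singleton, not_or] at hi
    exact hf i hi.1 hi.2
  refine ⟨Pi.single 0 1 + Pi.single j 1, Pi.single 0 1 - Pi.single j 1, ?_, ?_, ?_, ?_, ?_⟩
  · rw [lor, hs _ (by intro i h1 h2; simp [h1, h2])]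
    simp [hj, hj.symm]
    norm_num
  · simp [hj.symm]
  · rw [lor, hs _ (by intro i h1 h2; simp [h1, h2])]
    simp [hj, hj.symm]
    norm_num
  · simp [hj.symm]
  · rw [lorBil, hs _ (by intro i h1 h2; simp [h1, h2])]
    simp [hj, hj.symm]

theorem exists_lintegral_coneWeight_lt_top (hn : 2 ≤ n) {α : ℝ} (hα : -1 < α) :
    ∃ N : ℝ, 0 ≤ N ∧
      ∫⁻ z : Fin n → ℂ, coneWeight α (imP z) * ENNReal.ofReal ((1 + ‖z‖) ^ (-N)) < ⊤ := by
  set N₀ : ℝ := (Module.finrank ℝ (Fin n → ℂ) : ℝ) + 1 with hN₀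
  have hN₀0 : 0 ≤ N₀ := by positivity
  have hfin : ∫⁻ z : Fin n → ℂ, ENNReal.ofReal ((1 + ‖z‖) ^ (-N₀)) < ⊤ :=
    finite_integral_one_add_norm (by rw [hN₀]; linarith)
  rcases le_or_gt α 0 with h0 | h0
  · obtain ⟨u, v, hu, hu0, hv, hv0, huv⟩ := exists_lightlike hn
    refine ⟨N₀, hN₀0, ?_⟩
    set C : ℝ≥0∞ := 1 + ENNReal.ofReal (1 / (α + 1)) with hC
    have h1 : ∀ y : Fin n → ℝ, ∫⁻ t in Ioo (0 : ℝ) 1, coneWeight α (y - t • u) ≤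
        C * posPow α (lorBil y u) := by
      intro y
      by_cases hy : y ∈ cone n
      · set κ := lorBil y u with hκ
        have hκ0 : 0 < κ := lorBil_pos hy hu.ge hu0
        calc _ ≤ ∫⁻ t in Ioo (0 : ℝ) 1, ENNReal.ofReal (κ ^ α) * posPow α (lor y / κ - t) := by
              refine lintegral_mono fun t => (coneWeight_sub_le α t hu).trans (le_of_eq ?_)
              rw [← posPow_mul hκ0, ← hκ]
              congr 1
              field_simp
          _ ≤ ENNReal.ofReal (κ ^ α) * C := by
              rw [lintegral_const_mul' _ _ ENNReal.ofReal_ne_top]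
              gcongr
              exact lintegral_posPow_sub_le hα h0 _
          _ = _ := by rw [posPow_of_pos hκ0, mul_comm]
      · rw [setLIntegral_congr_fun (g := fun _ => 0) measurableSet_Ioo]
        · simp
        · exact fun t ht => coneWeight_sub_eq_zero α ht.1 hu hu0 hy
    have h2 : ∀ y : Fin n → ℝ, ∫⁻ t in Ioo (0 : ℝ) 1, C * posPow α (lorBil (y - t • v) u) ≤
        C * (ENNReal.ofReal (lorBil v u ^ α) * C) := by
      intro y
      rw [lintegral_const_mul' _ _ (by finiteness)]
      gcongr
      calc _ = ∫⁻ t in Ioo (0 : ℝ) 1, ENNReal.ofReal (lorBil v u ^ α) *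
            posPow α (lorBil y u / lorBil v u - t) := by
            refine lintegral_congr fun t => ?_
            rw [← posPow_mul huv, lorBil_sub_smul_left]
            congr 1
            field_simp
        _ ≤ _ := by
            rw [lintegral_const_mul' _ _ ENNReal.ofReal_ne_top]
            gcongr
            exact lintegral_posPow_sub_le hα h0 _
    have hm2 : Measurable fun y : Fin n → ℝ => C * posPow α (lorBil y u) := by
      refine ((measurable_posPow α).comp ?_).const_mul _
      unfold lorBil
      fun_prop
    have e1 := lintegral_mul_one_add_norm_le hN₀0 (measurable_coneWeight α) u h1
    have e2 := lintegral_mul_one_add_norm_le hN₀0 hm2 v h2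
    refine e1.trans_lt (ENNReal.mul_lt_top ENNReal.ofReal_lt_top (e2.trans_lt ?_))
    refine ENNReal.mul_lt_top ENNReal.ofReal_lt_top ?_
    rw [lintegral_const_mul' _ _ (by finiteness)]
    exact ENNReal.mul_lt_top (by finiteness) hfin
  · refine ⟨N₀ + 2 * α, by positivity, lt_of_le_of_lt (lintegral_mono fun z => ?_) hfin⟩
    by_cases hz : imP z ∈ cone n
    · rw [coneWeight_of_mem hz, ← ENNReal.ofReal_mul (Real.rpow_nonneg hz.1.le _)]
      refine ENNReal.ofReal_le_ofReal ?_
      have h1 : lor (imP z) ≤ (1 + ‖z‖) ^ (2 : ℝ) := by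
        refine (lor_le_sq _).trans ?_
        rw [Real.rpow_two]
        have : imP z 0 ≤ ‖z‖ :=
          ((le_abs_self _).trans (Complex.abs_im_le_norm (z 0))).trans (norm_le_pi_norm z 0)
        have := hz.2
        gcongr
        linarith
      have h2 := Real.rpow_le_rpow hz.1.le h1 h0.le
      rw [← Real.rpow_mul (by positivity)] at h2
      calc _ ≤ (1 + ‖z‖) ^ (2 * α) * (1 + ‖z‖) ^ (-(N₀ + 2 * α)) := by gcongr
        _ = _ := by
          rw [← Real.rpow_add (by positivity)]
          congr 1
          ring
    · rw [coneWeight_of_notMem hz, zero_mul]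
      exact zero_le

theorem tendsto_lintegral_enorm_sub_rpow {X E : Type*} [MeasurableSpace X] {μ : Measure X}
    [NormedAddCommGroup E] [MeasurableSpace E] [BorelSpace E] [SecondCountableTopology E]
    {p : ℝ} (hp : 1 ≤ p) {f : ℕ → X → E} {g : X → E} {b : ℕ → ℝ≥0∞}
    (hf : ∀ k, AEMeasurable (f k) μ) (hg : AEMeasurable g μ) (hgp : ∫⁻ x, ‖g x‖ₑ ^ p ∂μ ≠ ⊤)
    (hfb : ∀ k, ∫⁻ x, ‖f k x‖ₑ ^ p ∂μ ≤ b k)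
    (hb : Tendsto b atTop (𝓝 (∫⁻ x, ‖g x‖ₑ ^ p ∂μ)))
    (hfg : ∀ᵐ x ∂μ, Tendsto (fun k => f k x) atTop (𝓝 (g x))) :
    Tendsto (fun k => ∫⁻ x, ‖g x - f k x‖ₑ ^ p ∂μ) atTop (𝓝 0) := by
  have hp0 : 0 < p := by linarith
  set A := ∫⁻ x, ‖g x‖ₑ ^ p ∂μ with hA
  set c : ℝ≥0∞ := 2 ^ (p - 1) with hc
  have hct : c ≠ ⊤ := ENNReal.rpow_ne_top_of_nonneg (by linarith) (by simp)
  have hle : ∀ k x, ‖g x - f k x‖ₑ ^ p ≤ c * (‖f k x‖ₑ ^ p + ‖g x‖ₑ ^ p) := by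
    intro k x
    calc ‖g x - f k x‖ₑ ^ p ≤ (‖g x‖ₑ + ‖f k x‖ₑ) ^ p := by
          gcongr
          exact enorm_sub_le
      _ ≤ c * (‖g x‖ₑ ^ p + ‖f k x‖ₑ ^ p) := ENNReal.rpow_add_le_mul_rpow_add_rpow _ _ hp
      _ = _ := by rw [add_comm]
  let h : ℕ → X → ℝ≥0∞ := fun k x => c * (‖f k x‖ₑ ^ p + ‖g x‖ₑ ^ p) - ‖g x - f k x‖ₑ ^ p
  have hm1 : ∀ k, AEMeasurable (fun x => ‖g x - f k x‖ₑ ^ p) μ := fun k =>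
    (hg.sub (hf k)).enorm.pow_const p
  have hm : ∀ k, AEMeasurable (h k) μ := fun k =>
    ((((hf k).enorm.pow_const p).add (hg.enorm.pow_const p)).const_mul c).sub (hm1 k)
  have hlim : ∀ᵐ x ∂μ, 2 * c * ‖g x‖ₑ ^ p ≤ liminf (fun k => h k x) atTop := by
    filter_upwards [hfg] with x hx
    have t1 : Tendsto (fun k => c * (‖f k x‖ₑ ^ p + ‖g x‖ₑ ^ p)) atTop
        (𝓝 (c * (‖g x‖ₑ ^ p + ‖g x‖ₑ ^ p))) :=
      ENNReal.Tendsto.const_mul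
        (((ENNReal.continuous_rpow_const.tendsto _).comp hx.enorm).add tendsto_const_nhds)
        (Or.inr hct)
    have t2 : Tendsto (fun k => ‖g x - f k x‖ₑ ^ p) atTop (𝓝 0) := by
      have := ((ENNReal.continuous_rpow_const (y := p)).tendsto _).comp
        (tendsto_const_nhds (x := g x) |>.sub hx).enorm
      simpa [hp0, Function.comp_def] using this
    have t3 := ENNReal.Tendsto.sub t1 t2 (Or.inr (by simp))
    rw [t3.liminf_eq, tsub_zero]
    exact le_of_eq (by ring)
  have hfatou : 2 * c * A ≤ liminf (fun k => ∫⁻ x, h k x ∂μ) atTop := by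
    refine le_trans ?_ (lintegral_liminf_le' hm)
    rw [hA, ← lintegral_const_mul' _ _ (by finiteness)]
    exact lintegral_mono_ae hlim
  have hsum : ∀ k, (∫⁻ x, ‖g x - f k x‖ₑ ^ p ∂μ) + ∫⁻ x, h k x ∂μ ≤ c * (b k + A) := by
    intro k
    rw [← lintegral_add_left' (hm1 k)]
    calc _ = ∫⁻ x, c * (‖f k x‖ₑ ^ p + ‖g x‖ₑ ^ p) ∂μ :=
          lintegral_congr fun x => add_tsub_cancel_of_le (hle k x)
      _ = c * ((∫⁻ x, ‖f k x‖ₑ ^ p ∂μ) + A) := by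
          rw [lintegral_const_mul' _ _ hct, lintegral_add_right' _ (hg.enorm.pow_const p)]
      _ ≤ _ := by
          gcongr
          exact hfb k
  have hB : Tendsto (fun k => c * (b k + A)) atTop (𝓝 (2 * c * A)) := by
    have := ENNReal.Tendsto.const_mul (hb.add (tendsto_const_nhds (x := A))) (Or.inr hct)
    rwa [show c * (A + A) = 2 * c * A by ring] at this
  have hAt : 2 * c * A ≠ ⊤ := by finiteness
  rw [ENNReal.tendsto_nhds_zero]
  intro η hη
  rcases eq_or_ne η ⊤ with rfl | hηt
  · simp
  have hη2 : η / 2 ≠ 0 := by simpa using hη.ne'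
  have hη2t : η / 2 ≠ ⊤ := by finiteness
  have e1 : ∀ᶠ k in atTop, 2 * c * A ≤ (∫⁻ x, h k x ∂μ) + η / 2 := by
    rcases eq_or_ne (2 * c * A) 0 with h0 | h0
    · simp [h0]
    · have := eventually_lt_of_lt_liminf ((ENNReal.sub_lt_self hAt h0 hη2).trans_le hfatou)
      filter_upwards [this] with k hk
      exact tsub_le_iff_right.1 hk.le
  have e2 : ∀ᶠ k in atTop, c * (b k + A) < 2 * c * A + η / 2 :=
    hB.eventually_lt_const (ENNReal.lt_add_right hAt hη2)
  filter_upwards [e1, e2] with k h1 h2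
  have h3 := (hsum k).trans h2.le
  have hfin : (∫⁻ x, h k x ∂μ) ≠ ⊤ :=
    ne_top_of_le_ne_top (by finiteness) (le_add_self.trans h3)
  have h4 : (∫⁻ x, ‖g x - f k x‖ₑ ^ p ∂μ) + ∫⁻ x, h k x ∂μ ≤ η + ∫⁻ x, h k x ∂μ := by
    calc _ ≤ 2 * c * A + η / 2 := h3
      _ ≤ (∫⁻ x, h k x ∂μ) + η / 2 + η / 2 := by gcongr
      _ = _ := by rw [add_assoc, ENNReal.add_halves, add_comm]
  exact (ENNReal.add_le_add_iff_right hfin).1 h4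

theorem ae_mem_tube (ν : ℝ) : ∀ᵐ z ∂dV n ν, z ∈ tube n :=
  (withDensity_absolutelyContinuous _ _).ae_le (ae_restrict_mem isOpen_tube.measurableSet)

theorem aemeasurable_dV (ν : ℝ) {F : (Fin n → ℂ) → ℂ} (hF : ContinuousOn F (tube n)) :
    AEMeasurable F (dV n ν) :=
  (hF.aemeasurable isOpen_tube.measurableSet).mono_ac (withDensity_absolutelyContinuous _ _)

theorem measurable_indicator_tube {F : (Fin n → ℂ) → ℂ} (hF : ContinuousOn F (tube n)) :
    Measurable ((tube n).indicator F) := by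
  classical
  rw [← Set.piecewise_eq_indicator]
  exact hF.measurable_piecewise continuousOn_const isOpen_tube.measurableSet

theorem add_smul_mem_tube {z : Fin n → ℂ} (hz : z ∈ tube n) {w : ℂ} (hw : 0 < w.im)
    {u : Fin n → ℝ} (hu : 0 ≤ lor u) (hu0 : 0 < u 0) : (z + w • fun i => (u i : ℂ)) ∈ tube n := by
  have h := add_mem_cone (u := w.im • u) hz
    (by rw [lor_smul]; positivity) (by simp; positivity)
  have e := imP_sub_smul z (-w) u
  rw [neg_smul, sub_neg_eq_add, Complex.neg_im, neg_smul, sub_neg_eq_add] at e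
  change imP _ ∈ cone n
  rw [e]
  exact h

theorem DifferentiableOn.comp_add_smul {F : (Fin n → ℂ) → ℂ} (hF : DifferentiableOn ℂ F (tube n))
    {w : ℂ} (hw : 0 < w.im) {u : Fin n → ℝ} (hu : 0 ≤ lor u) (hu0 : 0 < u 0) :
    DifferentiableOn ℂ (fun z => F (z + w • fun i => (u i : ℂ))) (tube n) :=
  hF.comp (by fun_prop) fun _ hz => add_smul_mem_tube hz hw hu hu0

/-- The integral of `coneWeight α` over translates of `y` along `-u`, at scale `δ`. -/
def segWeight (α : ℝ) (u : Fin n → ℝ) (δ : ℝ) (y : Fin n → ℝ) : ℝ≥0∞ :=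
  ∫⁻ ζ in ball (0 : ℂ) (1 / 2), coneWeight α (y - (δ * (1 + ζ.im)) • u)

theorem measurable_segWeight (α : ℝ) (u : Fin n → ℝ) (δ : ℝ) : Measurable (segWeight α u δ) := by
  unfold segWeight
  refine Measurable.lintegral_prod_right'
    (f := fun q : (Fin n → ℝ) × ℂ => coneWeight α (q.1 - (δ * (1 + q.2.im)) • u)) ?_
  exact (measurable_coneWeight α).comp (by fun_prop)

theorem tendsto_segWeight (α : ℝ) (u : Fin n → ℝ) {y : Fin n → ℝ} (hy : y ∈ cone n) :
    Tendsto (fun δ => segWeight α u δ y) (𝓝[>] 0)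
      (𝓝 (coneWeight α y * volume (ball (0 : ℂ) (1 / 2)))) := by
  have hfin : coneWeight α y ≠ ⊤ := by
    rw [coneWeight_of_mem hy]
    exact ENNReal.ofReal_ne_top
  have hc := continuousAt_coneWeight α hy
  rw [← setLIntegral_const]
  refine tendsto_lintegral_filter_of_dominated_convergence (fun _ => coneWeight α y + 1)
    ?_ ?_ ?_ ?_
  · exact .of_forall fun δ => (measurable_coneWeight α).comp (by fun_prop)
  · obtain ⟨r, hr, hball⟩ := Metric.eventually_nhds_iff.1
      (hc.eventually_lt_const (ENNReal.lt_add_right hfin one_ne_zero))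
    have : ∀ᶠ δ : ℝ in 𝓝[>] 0, δ * (2 * ‖u‖) < r := by
      have h : Tendsto (fun δ : ℝ => δ * (2 * ‖u‖)) (𝓝[>] 0) (𝓝 0) := by
        have : Continuous fun δ : ℝ => δ * (2 * ‖u‖) := by fun_prop
        simpa using (this.tendsto 0).mono_left nhdsWithin_le_nhds
      exact h.eventually_lt_const hr
    filter_upwards [this, self_mem_nhdsWithin] with δ hδ hδ0
    filter_upwards [ae_restrict_mem measurableSet_ball] with ζ hζ
    refine (hball ?_).le
    have hζ' := abs_lt.1 (abs_im_lt_of_mem_ball hζ)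
    have hδ0 : 0 < δ := hδ0
    rw [dist_eq_norm, sub_sub_cancel_left, norm_neg, norm_smul, Real.norm_eq_abs, abs_mul,
      abs_of_pos hδ0, abs_of_pos (by linarith : (0 : ℝ) < 1 + ζ.im), mul_assoc]
    refine lt_of_le_of_lt ?_ hδ
    gcongr
    linarith
  · rw [setLIntegral_const]
    have : volume (ball (0 : ℂ) (1 / 2)) ≠ ⊤ := measure_ball_lt_top.ne
    finiteness
  · refine .of_forall fun ζ => hc.tendsto.comp ?_
    have : Continuous fun δ : ℝ => y - (δ * (1 + ζ.im)) • u := by fun_prop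
    simpa using (this.tendsto 0).mono_left nhdsWithin_le_nhds

theorem lpInt_comp_add_smul_le {p ν : ℝ} (hp : 1 ≤ p) {F : (Fin n → ℂ) → ℂ}
    (hF : DifferentiableOn ℂ F (tube n)) {u : Fin n → ℝ} (hu : lor u = 0) (hu0 : 0 < u 0)
    {δ : ℝ} (hδ : 0 < δ) :
    lpInt n p ν (fun z => F (z + (δ * I) • fun i => (u i : ℂ))) *
        volume (ball (0 : ℂ) (1 / 2)) ≤
      ∫⁻ z, segWeight (ν - n / 2) u δ (imP z) * ‖(tube n).indicator F z‖ₑ ^ p := by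
  set α := ν - n / 2 with hα
  set uC : Fin n → ℂ := fun i => (u i : ℂ) with huC
  set G := (tube n).indicator F with hG
  have hGm : Measurable G := measurable_indicator_tube hF.continuousOn
  have him : ∀ ζ ∈ ball (0 : ℂ) (1 / 2), 0 < (δ * (I + ζ)).im := by
    intro ζ hζ
    have hζ' := abs_lt.1 (abs_im_lt_of_mem_ball hζ)
    simp only [mul_im, ofReal_re, add_im, I_im, ofReal_im, zero_mul, add_zero]
    exact mul_pos hδ (by linarith)
  have hmean : ∀ z, coneWeight α (imP z) * ‖F (z + (δ * I) • uC)‖ₑ ^ p *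
      volume (ball (0 : ℂ) (1 / 2)) ≤
      ∫⁻ ζ in ball (0 : ℂ) (1 / 2), coneWeight α (imP z) * ‖G (z + (δ * (I + ζ)) • uC)‖ₑ ^ p := by
    intro z
    by_cases hz : z ∈ tube n
    · rw [lintegral_const_mul' _ _ (by rw [coneWeight_of_mem hz]; finiteness), mul_assoc]
      gcongr
      have hd : DifferentiableOn ℂ (fun ζ : ℂ => F (z + (δ * (I + ζ)) • uC)) (ball 0 (1 / 2)) :=
        hF.comp (by fun_prop) fun ζ hζ => add_smul_mem_tube hz (him ζ hζ) hu.ge hu0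
      have := enorm_rpow_mul_measure_ball_le (volume : Measure ℂ) measurePreserving_exp_smul hd hp
      simp only [add_zero] at this
      refine this.trans (le_of_eq (setLIntegral_congr_fun measurableSet_ball fun ζ hζ => ?_))
      simp only [hG]
      rw [indicator_of_mem (add_smul_mem_tube hz (him ζ hζ) hu.ge hu0)]
    · rw [coneWeight_of_notMem hz]
      simp
  rw [lpInt_eq (by linarith), ← lintegral_mul_const' _ _ measure_ball_lt_top.ne]
  have hWm := measurable_coneWeight (n := n) α
  have hIm := (continuous_imP (n := n)).measurable
  calc _ ≤ ∫⁻ z, ∫⁻ ζ in ball (0 : ℂ) (1 / 2),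
        coneWeight α (imP z) * ‖G (z + (δ * (I + ζ)) • uC)‖ₑ ^ p := lintegral_mono hmean
    _ = ∫⁻ ζ in ball (0 : ℂ) (1 / 2), ∫⁻ z,
        coneWeight α (imP z) * ‖G (z + (δ * (I + ζ)) • uC)‖ₑ ^ p := by
        refine lintegral_lintegral_swap (Measurable.aemeasurable ?_)
        refine (hWm.comp (hIm.comp measurable_fst)).mul ?_
        refine Measurable.pow_const (Measurable.enorm (hGm.comp ?_)) p
        fun_prop
    _ = ∫⁻ ζ in ball (0 : ℂ) (1 / 2), ∫⁻ z,
        coneWeight α (imP z - (δ * (1 + ζ.im)) • u) * ‖G z‖ₑ ^ p := by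
        refine lintegral_congr fun ζ => ?_
        rw [← lintegral_sub_right_eq_self _ ((δ * (I + ζ)) • uC)]
        refine lintegral_congr fun z => ?_
        rw [imP_sub_smul, sub_add_cancel]
        simp
    _ = ∫⁻ z, ∫⁻ ζ in ball (0 : ℂ) (1 / 2),
        coneWeight α (imP z - (δ * (1 + ζ.im)) • u) * ‖G z‖ₑ ^ p := by
        refine lintegral_lintegral_swap (Measurable.aemeasurable ?_)
        refine Measurable.mul (hWm.comp ?_) ((hGm.comp measurable_snd).enorm.pow_const p)
        fun_prop
    _ = _ := by
        refine lintegral_congr fun z => ?_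
        rw [lintegral_mul_const' _ _ (by finiteness), segWeight]

theorem exists_translate_close {p ν : ℝ} (hp : 1 ≤ p) (hν : (n : ℝ) / 2 - 1 < ν)
    {F : (Fin n → ℂ) → ℂ} (hF : memA n p ν F) {u : Fin n → ℝ} (hu : lor u = 0) (hu0 : 0 < u 0)
    {η : ℝ≥0∞} (hη : 0 < η) :
    ∃ δ : ℝ, 0 < δ ∧ memA n p ν (fun z => F (z + (δ * I) • fun i => (u i : ℂ))) ∧
      lpInt n p ν (fun z => F z - F (z + (δ * I) • fun i => (u i : ℂ))) < η := by
  have hp0 : 0 ≤ p := by linarith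
  set α := ν - n / 2 with hα
  have hα1 : -1 < α := by linarith
  set uC : Fin n → ℂ := fun i => (u i : ℂ) with huC
  set V := volume (ball (0 : ℂ) (1 / 2)) with hV
  have hV0 : V ≠ 0 := (measure_ball_pos _ _ (by norm_num)).ne'
  have hVt : V ≠ ⊤ := measure_ball_lt_top.ne
  set G := (tube n).indicator F with hG
  have hGm : Measurable G := measurable_indicator_tube hF.1.continuousOn
  have hGF : ∀ z, coneWeight α (imP z) * ‖G z‖ₑ ^ p = coneWeight α (imP z) * ‖F z‖ₑ ^ p := by
    intro z
    by_cases hz : z ∈ tube n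
    · rw [hG, indicator_of_mem hz]
    · rw [coneWeight_of_notMem hz, zero_mul, zero_mul]
  have hFint : ∫⁻ z, coneWeight α (imP z) * ‖F z‖ₑ ^ p < ⊤ := by
    have := hF.2
    rwa [lpInt_eq hp0] at this
  obtain ⟨C, hC, hCb⟩ := exists_lintegral_ball_coneWeight_le n hα1
  have hmaj : ∀ δ > 0, ∀ z, segWeight α u δ (imP z) * ‖G z‖ₑ ^ p ≤
      C * (coneWeight α (imP z) * ‖F z‖ₑ ^ p) := by
    intro δ hδ z
    rw [← hGF, ← mul_assoc]
    gcongr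
    exact hCb u hu hu0 δ hδ _
  let B : ℝ → ℝ≥0∞ := fun δ => ∫⁻ z, segWeight α u δ (imP z) * ‖G z‖ₑ ^ p
  have hBfin : ∀ δ > 0, B δ < ⊤ := by
    intro δ hδ
    refine (lintegral_mono (hmaj δ hδ)).trans_lt ?_
    rw [lintegral_const_mul' _ _ hC]
    exact ENNReal.mul_lt_top hC.lt_top hFint
  have hmem : ∀ δ : ℝ, 0 < δ → memA n p ν (fun z => F (z + (δ * I) • uC)) := by
    intro δ hδ
    refine ⟨hF.1.comp_add_smul (by simpa using hδ) hu.ge hu0, ?_⟩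
    have := (lpInt_comp_add_smul_le (ν := ν) hp hF.1 hu hu0 hδ).trans_lt (hBfin δ hδ)
    refine lt_top_iff_ne_top.2 fun h => ?_
    rw [← huC, h, ENNReal.top_mul hV0] at this
    exact this.ne rfl
  have hBlim : Tendsto B (𝓝[>] 0) (𝓝 (lpInt n p ν F * V)) := by
    rw [lpInt_eq hp0, ← lintegral_mul_const' _ _ hVt]
    refine tendsto_lintegral_filter_of_dominated_convergence
      (fun z => C * (coneWeight α (imP z) * ‖F z‖ₑ ^ p)) ?_ ?_ ?_ ?_
    · exact .of_forall fun δ => ((measurable_segWeight α u δ).comp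
        continuous_imP.measurable).mul (hGm.enorm.pow_const p)
    · filter_upwards [self_mem_nhdsWithin] with δ hδ
      exact .of_forall (hmaj δ hδ)
    · rw [lintegral_const_mul' _ _ hC]
      exact (ENNReal.mul_lt_top hC.lt_top hFint).ne
    · refine .of_forall fun z => ?_
      by_cases hz : z ∈ tube n
      · have := ENNReal.Tendsto.mul_const (b := ‖F z‖ₑ ^ p) (tendsto_segWeight α u hz)
          (Or.inr (by finiteness))
        rw [hG, indicator_of_mem hz]
        rwa [mul_right_comm] at this
      · rw [hG, indicator_of_notMem hz, coneWeight_of_notMem hz]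
        simp [show 0 < p by linarith]
  set s : ℕ → ℝ := fun k => 1 / ((k : ℝ) + 1) with hs
  have hs0 : ∀ k, 0 < s k := fun k => by positivity
  have hslim : Tendsto s atTop (𝓝[>] 0) :=
    tendsto_nhdsWithin_iff.2 ⟨tendsto_one_div_add_atTop_nhds_zero_nat, .of_forall hs0⟩
  have key : Tendsto (fun k => ∫⁻ z, ‖F z - F (z + ((s k : ℂ) * I) • uC)‖ₑ ^ p ∂dV n ν) atTop
      (𝓝 0) := by
    refine tendsto_lintegral_enorm_sub_rpow (b := fun k => B (s k) / V) hp
      (fun k => aemeasurable_dV ν (hmem _ (hs0 k)).1.continuousOn)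
      (aemeasurable_dV ν hF.1.continuousOn) ?_ ?_ ?_ ?_
    · simpa only [lpInt, ofReal_norm_rpow hp0] using hF.2.ne
    · intro k
      rw [ENNReal.le_div_iff_mul_le (Or.inl hV0) (Or.inl hVt)]
      simpa only [lpInt, ofReal_norm_rpow hp0] using
        lpInt_comp_add_smul_le (ν := ν) hp hF.1 hu hu0 (hs0 k)
    · have := ENNReal.Tendsto.div_const (hBlim.comp hslim) (Or.inr hV0)
      rw [ENNReal.mul_div_cancel_right hV0 hVt] at this
      simpa only [lpInt, ofReal_norm_rpow hp0, Function.comp_def] using this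
    · filter_upwards [ae_mem_tube ν] with z hz
      have h1 : ContinuousAt F z := hF.1.continuousOn.continuousAt (isOpen_tube.mem_nhds hz)
      refine h1.tendsto.comp ?_
      have h2 : Continuous fun δ : ℝ => z + ((δ : ℂ) * I) • uC := by fun_prop
      have h3 := (h2.tendsto 0).comp (hslim.mono_right nhdsWithin_le_nhds)
      simpa [Function.comp_def] using h3
  obtain ⟨k, hk⟩ := (key.eventually_lt_const hη).exists
  refine ⟨s k, hs0 k, hmem _ (hs0 k), ?_⟩
  simpa only [lpInt, ofReal_norm_rpow hp0] using hk

theorem norm_imP_le {n : ℕ} (z : Fin n → ℂ) : ‖imP z‖ ≤ ‖z‖ :=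
  (pi_norm_le_iff_of_nonneg (norm_nonneg _)).2 fun i =>
    (Complex.abs_im_le_norm (z i)).trans (norm_le_pi_norm z i)

theorem one_le_mul_rpow_of_le {α c K X t : ℝ} (hα : -1 < α) (hc : 0 < c) (hK : 1 ≤ K)
    (hX : 1 ≤ X) (hct : c ≤ t) (htX : t ≤ (K * X) ^ 2) :
    1 ≤ (c ^ (-α) + K ^ 2) * X ^ 2 * t ^ α := by
  have ht : 0 < t := hc.trans_le hct
  have hX2 : 1 ≤ X ^ 2 := one_le_pow₀ hX
  have htα : 0 < t ^ α := Real.rpow_pos_of_pos ht α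
  have hcα : 0 < c ^ (-α) := Real.rpow_pos_of_pos hc _
  rcases le_or_gt 0 α with h | h
  · calc (1 : ℝ) = c ^ (-α) * 1 * c ^ α := by
          rw [mul_one, ← Real.rpow_add hc, neg_add_cancel, Real.rpow_zero]
      _ ≤ _ := by
          gcongr
          exact le_add_of_nonneg_right (by positivity)
  · have hKX : 1 ≤ (K * X) ^ 2 := one_le_pow₀ (one_le_mul_of_one_le_of_one_le hK hX)
    have h1 : ((K * X) ^ 2)⁻¹ ≤ t ^ α := by
      rw [← Real.rpow_neg_one]
      exact (Real.rpow_le_rpow_of_exponent_le hKX hα.le).trans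
        (Real.rpow_le_rpow_of_nonpos ht htX h.le)
    calc (1 : ℝ) = K ^ 2 * X ^ 2 * ((K * X) ^ 2)⁻¹ := by
          rw [← mul_pow, mul_inv_cancel₀ (by positivity)]
      _ ≤ _ := by
          gcongr
          exact le_add_of_nonneg_left hcα.le

theorem exists_norm_translate_le {p ν : ℝ} (hp : 1 ≤ p) (hν : (n : ℝ) / 2 - 1 < ν)
    {F : (Fin n → ℂ) → ℂ} (hF : memA n p ν F) {s : Fin n → ℝ} (hs : s ∈ cone n) :
    ∃ C : ℝ, ∀ z ∈ tube n, ‖F (z + I • fun i => (s i : ℂ))‖ ≤ C * (1 + ‖z‖) ^ 2 := by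
  have hp0 : 0 ≤ p := by linarith
  set α := ν - n / 2 with hα
  have hα1 : -1 < α := by linarith
  set sC : Fin n → ℂ := fun i => (s i : ℂ) with hsC
  have hls : 0 < lor s := hs.1
  obtain ⟨r, hr, hball⟩ : ∃ r > 0, ∀ x, dist x s < r → x ∈ cone n ∧ lor s / 2 < lor x :=
    Metric.eventually_nhds_iff.1 ((isOpen_cone.eventually_mem hs).and
      (continuous_lor.continuousAt.eventually_const_lt (by linarith)))
  set K : ℝ := 1 + ‖s‖ + r with hK
  have hK1 : 1 ≤ K := by linarith [norm_nonneg s]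
  set C₁ : ℝ := (lor s / 2) ^ (-α) + K ^ 2 with hC₁
  have hC₁0 : 0 ≤ C₁ := by positivity
  have him : ∀ z v : Fin n → ℂ, imP (z + I • sC + v) = imP z + (s + imP v) := by
    intro z v
    ext i
    simp [imP, hsC, add_assoc]
  have hx : ∀ v ∈ ball (0 : Fin n → ℂ) r, s + imP v ∈ cone n ∧ lor s / 2 < lor (s + imP v) := by
    intro v hv
    refine hball _ ?_
    rw [dist_eq_norm, add_sub_cancel_left]
    exact (norm_imP_le v).trans_lt (by simpa using hv)
  have hmem : ∀ z ∈ tube n, ∀ v ∈ ball (0 : Fin n → ℂ) r, z + I • sC + v ∈ tube n := by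
    intro z hz v hv
    change imP _ ∈ cone n
    rw [him]
    exact add_mem_cone hz (hx v hv).1.1.le (hx v hv).1.2
  have hw : ∀ z ∈ tube n, ∀ v ∈ ball (0 : Fin n → ℂ) r,
      1 ≤ ENNReal.ofReal (C₁ * (1 + ‖z‖) ^ 2) * coneWeight α (imP (z + I • sC + v)) := by
    intro z hz v hv
    have hm : imP (z + I • sC + v) ∈ cone n := hmem z hz v hv
    rw [coneWeight_of_mem hm, ← ENNReal.ofReal_mul (by positivity), ENNReal.one_le_ofReal]
    refine one_le_mul_rpow_of_le hα1 (by linarith) hK1 (by linarith [norm_nonneg z]) ?_ ?_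
    · rw [him]
      have := lor_le_lor_add hz (hx v hv).1.1.le (hx v hv).1.2
      linarith [hz.1, (hx v hv).2]
    · refine (lor_le_sq _).trans ?_
      have h0 := hm.2
      gcongr
      have h1 : imP (z + I • sC + v) 0 ≤ ‖z‖ + (‖s‖ + r) := by
        rw [him]
        refine ((le_abs_self _).trans (norm_le_pi_norm (imP z + (s + imP v)) 0)).trans
          ((norm_add_le _ _).trans ?_)
        refine add_le_add (norm_imP_le z) ((norm_add_le _ _).trans ?_)
        gcongr
        exact (norm_imP_le v).trans (by simpa using (mem_ball.1 hv).le)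
      nlinarith [norm_nonneg z, norm_nonneg s]
  set V := volume (ball (0 : Fin n → ℂ) r) with hV
  have hV0 : V ≠ 0 := (measure_ball_pos _ _ hr).ne'
  have hVt : V ≠ ⊤ := measure_ball_lt_top.ne
  set L := lpInt n p ν F / V with hL
  have hLt : L ≠ ⊤ := ENNReal.div_ne_top hF.2.ne hV0
  refine ⟨1 + C₁ * L.toReal, fun z hz => ?_⟩
  have hmean : ‖F (z + I • sC)‖ₑ ^ p * V ≤
      ENNReal.ofReal (C₁ * (1 + ‖z‖) ^ 2) * lpInt n p ν F := by
    have hd : DifferentiableOn ℂ (fun v => F (z + I • sC + v)) (ball 0 r) :=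
      hF.1.comp (by fun_prop) (hmem z hz)
    have := enorm_rpow_mul_measure_ball_le (volume : Measure (Fin n → ℂ))
      measurePreserving_exp_smul_pi hd hp
    simp only [add_zero] at this
    refine this.trans ?_
    rw [lpInt_eq hp0, ← lintegral_const_mul' _ _ (by finiteness)]
    calc _ ≤ ∫⁻ v in ball (0 : Fin n → ℂ) r, ENNReal.ofReal (C₁ * (1 + ‖z‖) ^ 2) *
          (coneWeight α (imP (z + I • sC + v)) * ‖F (z + I • sC + v)‖ₑ ^ p) := by
          refine setLIntegral_mono' measurableSet_ball fun v hv => ?_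
          rw [← mul_assoc]
          exact le_mul_of_one_le_left' (hw z hz v hv)
      _ ≤ ∫⁻ v, ENNReal.ofReal (C₁ * (1 + ‖z‖) ^ 2) *
          (coneWeight α (imP (z + I • sC + v)) * ‖F (z + I • sC + v)‖ₑ ^ p) :=
          setLIntegral_le_lintegral _ _
      _ = _ := lintegral_add_left_eq_self (fun w => ENNReal.ofReal (C₁ * (1 + ‖z‖) ^ 2) *
          (coneWeight α (imP w) * ‖F w‖ₑ ^ p)) (z + I • sC)
  have h2 : ‖F (z + I • sC)‖ ^ p ≤ C₁ * (1 + ‖z‖) ^ 2 * L.toReal := by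
    rw [← ENNReal.le_div_iff_mul_le (Or.inl hV0) (Or.inl hVt), mul_div_assoc, ← hL,
      ← ofReal_norm_rpow hp0] at hmean
    have := ENNReal.toReal_mono (by finiteness) hmean
    rwa [ENNReal.toReal_ofReal (by positivity), ENNReal.toReal_mul,
      ENNReal.toReal_ofReal (by positivity)] at this
  have h3 : ‖F (z + I • sC)‖ ≤ 1 + ‖F (z + I • sC)‖ ^ p := by
    rcases le_total ‖F (z + I • sC)‖ 1 with h | h
    · linarith [Real.rpow_nonneg (norm_nonneg (F (z + I • sC))) p]
    · linarith [Real.self_le_rpow_of_one_le h hp]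
  have h4 : 1 ≤ (1 + ‖z‖) ^ 2 := one_le_pow₀ (by linarith [norm_nonneg z])
  linarith

/-- The polynomial `∏ⱼ (1 - iε(z₀ + zⱼ))`, whose inverse powers damp functions on the tube. -/
def dampPoly (ε : ℝ) (z : Fin n → ℂ) : ℂ := ∏ j, (1 - I * (ε * (z 0 + z j)))

theorem differentiable_dampPoly (ε : ℝ) :
    Differentiable ℂ (dampPoly ε : (Fin n → ℂ) → ℂ) := by
  unfold dampPoly
  fun_prop

theorem tendsto_dampPoly (z : Fin n → ℂ) : Tendsto (fun ε => dampPoly ε z) (𝓝 0) (𝓝 1) := by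
  have : Continuous fun ε : ℝ => dampPoly ε z := by
    unfold dampPoly
    fun_prop
  simpa [dampPoly] using this.tendsto 0

theorem one_le_norm_one_sub {w : ℂ} (hw : 0 ≤ w.im) : 1 ≤ ‖1 - I * w‖ :=
  calc (1 : ℝ) ≤ (1 - I * w).re := by simpa using hw
    _ ≤ _ := re_le_norm _

theorem norm_le_norm_one_sub {w : ℂ} (hw : 0 ≤ w.im) : ‖w‖ ≤ ‖1 - I * w‖ := by
  rw [← sq_le_sq₀ (norm_nonneg _) (norm_nonneg _), ← normSq_eq_norm_sq, ← normSq_eq_norm_sq,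
    normSq_apply, normSq_apply]
  simp
  nlinarith

theorem im_add_pos {z : Fin n → ℂ} (hz : z ∈ tube n) (j : Fin n) : 0 < (z 0 + z j).im := by
  rcases eq_or_ne j 0 with rfl | hj
  · have : 0 < (z 0).im := hz.2
    simp [this]
  · have := (abs_lt.1 (abs_lt_of_mem_cone hz hj)).1
    simp only [imP] at this
    rw [add_im]
    linarith

theorem norm_le_norm_dampPoly {ε : ℝ} (hε : 0 < ε) {z : Fin n → ℂ} (hz : z ∈ tube n) :
    1 ≤ ‖dampPoly ε z‖ ∧ ∀ j, ε * ‖z 0 + z j‖ ≤ ‖dampPoly ε z‖ := by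
  have him : ∀ j, 0 ≤ (ε * (z 0 + z j)).im := by
    intro j
    have := im_add_pos hz j
    rw [im_ofReal_mul]
    positivity
  have hprod : ∀ S : Finset (Fin n), 1 ≤ ‖∏ j ∈ S, (1 - I * (ε * (z 0 + z j)))‖ := by
    intro S
    rw [norm_prod]
    exact Finset.prod_induction _ (fun x : ℝ => 1 ≤ x)
      (fun _ _ => one_le_mul_of_one_le_of_one_le) le_rfl fun j _ => one_le_norm_one_sub (him j)
  refine ⟨hprod _, fun j => ?_⟩
  rw [dampPoly, ← Finset.mul_prod_erase _ _ (Finset.mem_univ j), norm_mul]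
  have h1 := norm_le_norm_one_sub (him j)
  rw [norm_mul, norm_real, Real.norm_eq_abs, abs_of_pos hε] at h1
  exact h1.trans (le_mul_of_one_le_right (norm_nonneg _) (hprod _))

theorem one_add_norm_le_norm_dampPoly {ε : ℝ} (hε : 0 < ε) {z : Fin n → ℂ} (hz : z ∈ tube n) :
    1 + ‖z‖ ≤ (1 + 2 / ε) * ‖dampPoly ε z‖ := by
  obtain ⟨h1, h2⟩ := norm_le_norm_dampPoly hε hz
  have h3 : ∀ j, ‖z 0 + z j‖ ≤ ‖dampPoly ε z‖ / ε := fun j => by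
    rw [le_div_iff₀ hε, mul_comm]
    exact h2 j
  have h0 : ‖z 0‖ ≤ ‖dampPoly ε z‖ / ε := by
    have := h3 0
    rw [← two_mul, norm_mul, norm_ofNat] at this
    linarith [norm_nonneg (z 0)]
  have hz' : ‖z‖ ≤ 2 * (‖dampPoly ε z‖ / ε) := by
    refine (pi_norm_le_iff_of_nonneg (by positivity)).2 fun j => ?_
    calc ‖z j‖ = ‖(z 0 + z j) - z 0‖ := by rw [add_sub_cancel_left]
      _ ≤ ‖z 0 + z j‖ + ‖z 0‖ := norm_sub_le _ _
      _ ≤ _ := by linarith [h3 j]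
  calc 1 + ‖z‖ ≤ ‖dampPoly ε z‖ + 2 * (‖dampPoly ε z‖ / ε) := add_le_add h1 hz'
    _ = _ := by ring

theorem memA_of_norm_le (hn : 2 ≤ n) {q μ : ℝ} (hq : 1 ≤ q) (hμ : (n : ℝ) / 2 - 1 < μ) :
    ∃ M : ℕ, ∀ (G : (Fin n → ℂ) → ℂ) (C : ℝ), DifferentiableOn ℂ G (tube n) →
      (∀ z ∈ tube n, ‖G z‖ * (1 + ‖z‖) ^ M ≤ C) → memA n q μ G := by
  obtain ⟨N, hN, hfin⟩ := exists_lintegral_coneWeight_lt_top (n := n) hn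
    (α := μ - n / 2) (by linarith)
  have hq0 : 0 ≤ q := by linarith
  obtain ⟨M, hM⟩ := exists_nat_ge N
  refine ⟨M, fun G C hG hC => ⟨hG, ?_⟩⟩
  rw [lpInt_eq hq0]
  have hpt : ∀ z, coneWeight (μ - n / 2) (imP z) * ‖G z‖ₑ ^ q ≤ ENNReal.ofReal (C ^ q) *
      (coneWeight (μ - n / 2) (imP z) * ENNReal.ofReal ((1 + ‖z‖) ^ (-N))) := by
    intro z
    by_cases hz : z ∈ tube n
    · have hX : 1 ≤ 1 + ‖z‖ := by linarith [norm_nonneg z]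
      have hC0 : 0 ≤ C := le_trans (by positivity) (hC z hz)
      rw [mul_left_comm]
      gcongr
      rw [← ofReal_norm_rpow hq0, ← ENNReal.ofReal_mul (by positivity)]
      refine ENNReal.ofReal_le_ofReal ?_
      have h1 := Real.rpow_le_rpow (by positivity) (hC z hz) hq0
      rw [Real.mul_rpow (by positivity) (by positivity)] at h1
      rw [Real.rpow_neg (by positivity), ← div_eq_mul_inv, le_div_iff₀ (by positivity)]
      refine le_trans ?_ h1
      gcongr
      rw [← Real.rpow_natCast, ← Real.rpow_mul (by positivity)]
      refine Real.rpow_le_rpow_of_exponent_le hX ?_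
      nlinarith
    · rw [coneWeight_of_notMem hz, zero_mul]
      exact zero_le
  refine (lintegral_mono hpt).trans_lt ?_
  rw [lintegral_const_mul' _ _ (by finiteness)]
  exact ENNReal.mul_lt_top (by finiteness) hfin

theorem exists_damped_close (hn : 2 ≤ n) {p ν : ℝ} (hp : 1 ≤ p) {H : (Fin n → ℂ) → ℂ}
    (hH : memA n p ν H) {C : ℝ} (hC : ∀ z ∈ tube n, ‖H z‖ ≤ C * (1 + ‖z‖) ^ 2)
    {q μ : ℝ} (hq : 1 ≤ q) (hμ : (n : ℝ) / 2 - 1 < μ) {η : ℝ≥0∞} (hη : 0 < η) :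
    ∃ G, memA n p ν G ∧ memA n q μ G ∧ (∃ M : ℝ, ∀ z ∈ tube n, ‖G z‖ ≤ M) ∧
      lpInt n p ν (fun z => H z - G z) < η := by
  have hp0 : 0 ≤ p := by linarith
  obtain ⟨M, hM⟩ := memA_of_norm_le hn hq hμ
  let G : ℝ → (Fin n → ℂ) → ℂ := fun ε z => H z / dampPoly ε z ^ (M + 2)
  have hP0 : ∀ ε > 0, ∀ z ∈ tube n, 1 ≤ ‖dampPoly ε z‖ := fun ε hε z hz =>
    (norm_le_norm_dampPoly hε hz).1
  have hGd : ∀ ε > 0, DifferentiableOn ℂ (G ε) (tube n) := by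
    intro ε hε
    simp only [G, div_eq_mul_inv]
    refine hH.1.fun_mul (((differentiable_dampPoly ε).differentiableOn.fun_pow _).fun_inv ?_)
    intro z hz
    exact pow_ne_zero _ (norm_pos_iff.1 (by linarith [hP0 ε hε z hz]))
  have hGH : ∀ ε > 0, ∀ z ∈ tube n, ‖G ε z‖ ≤ ‖H z‖ := by
    intro ε hε z hz
    simp only [G]
    rw [norm_div, norm_pow]
    exact div_le_self (norm_nonneg _) (one_le_pow₀ (hP0 ε hε z hz))
  have hGb : ∀ ε > 0, ∀ z ∈ tube n, ‖G ε z‖ * (1 + ‖z‖) ^ M ≤ C * (1 + 2 / ε) ^ (M + 2) := by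
    intro ε hε z hz
    have h1 := hP0 ε hε z hz
    have hC0 : 0 ≤ C := by
      by_contra! h
      have := (norm_nonneg _).trans (hC z hz)
      have : C * (1 + ‖z‖) ^ 2 < 0 := mul_neg_of_neg_of_pos h (by positivity)
      linarith
    simp only [G]
    rw [norm_div, norm_pow, div_mul_eq_mul_div, div_le_iff₀ (by positivity)]
    calc ‖H z‖ * (1 + ‖z‖) ^ M ≤ C * (1 + ‖z‖) ^ 2 * (1 + ‖z‖) ^ M := by
          gcongr
          exact hC z hz
      _ = C * (1 + ‖z‖) ^ (M + 2) := by ring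
      _ ≤ C * ((1 + 2 / ε) * ‖dampPoly ε z‖) ^ (M + 2) := by
          gcongr
          exact one_add_norm_le_norm_dampPoly hε hz
      _ = _ := by rw [mul_pow, mul_assoc]
  have hlp : ∀ ε > 0, ∫⁻ z, ‖G ε z‖ₑ ^ p ∂dV n ν ≤ ∫⁻ z, ‖H z‖ₑ ^ p ∂dV n ν := by
    intro ε hε
    refine lintegral_mono_ae ?_
    filter_upwards [ae_mem_tube ν] with z hz
    gcongr
    exact enorm_le_iff_norm_le.2 (hGH ε hε z hz)
  have hHp : ∫⁻ z, ‖H z‖ₑ ^ p ∂dV n ν < ⊤ := by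
    simpa only [lpInt, ofReal_norm_rpow hp0] using hH.2
  set s : ℕ → ℝ := fun k => 1 / ((k : ℝ) + 1) with hs
  have hs0 : ∀ k, 0 < s k := fun k => by positivity
  have key : Tendsto (fun k => ∫⁻ z, ‖H z - G (s k) z‖ₑ ^ p ∂dV n ν) atTop (𝓝 0) := by
    refine tendsto_lintegral_enorm_sub_rpow hp
      (fun k => aemeasurable_dV ν (hGd _ (hs0 k)).continuousOn)
      (aemeasurable_dV ν hH.1.continuousOn) hHp.ne (fun k => hlp _ (hs0 k)) tendsto_const_nhds
      (.of_forall fun z => ?_)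
    have h1 := ((tendsto_dampPoly z).comp tendsto_one_div_add_atTop_nhds_zero_nat).pow (M + 2)
    have h2 := (tendsto_const_nhds (x := H z)).div h1 (by simp)
    rwa [one_pow, div_one] at h2
  obtain ⟨k, hk⟩ := (key.eventually_lt_const hη).exists
  refine ⟨G (s k), ⟨hGd _ (hs0 k), ?_⟩, hM _ _ (hGd _ (hs0 k)) (hGb _ (hs0 k)),
    ⟨_, fun z hz => le_trans ?_ (hGb _ (hs0 k) z hz)⟩, ?_⟩
  · simpa only [lpInt, ofReal_norm_rpow hp0] using (hlp _ (hs0 k)).trans_lt hHp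
  · exact le_mul_of_one_le_right (norm_nonneg _) (one_le_pow₀ (by linarith [norm_nonneg z]))
  · simpa only [lpInt, ofReal_norm_rpow hp0] using hk

theorem exists_lpInt_sub_lt {p : ℝ} (hp : 1 ≤ p) (ν : ℝ) {τ : ℝ≥0∞} (hτ : 0 < τ) :
    ∃ η : ℝ≥0∞, 0 < η ∧ ∀ F G H : (Fin n → ℂ) → ℂ, ContinuousOn F (tube n) →
      ContinuousOn G (tube n) → lpInt n p ν (fun z => F z - G z) < η →
      lpInt n p ν (fun z => G z - H z) < η → lpInt n p ν (fun z => F z - H z) < τ := by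
  have hp0 : 0 ≤ p := by linarith
  set c : ℝ≥0∞ := 2 ^ (p - 1) with hc
  have hct : c ≠ ⊤ := ENNReal.rpow_ne_top_of_nonneg (by linarith) (by simp)
  have hc0 : c ≠ 0 := (ENNReal.rpow_pos (by simp) (by simp)).ne'
  have h2c : 2 * c ≠ ⊤ := by finiteness
  have h2c0 : 2 * c ≠ 0 := by simp [hc0]
  refine ⟨τ / (2 * c), ENNReal.div_pos hτ.ne' h2c, fun F G H hF hG h1 h2 => ?_⟩
  simp only [lpInt, ofReal_norm_rpow hp0] at h1 h2 ⊢
  have hm : AEMeasurable (fun z => ‖F z - G z‖ₑ ^ p) (dV n ν) :=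
    (aemeasurable_dV ν (hF.sub hG)).enorm.pow_const p
  calc ∫⁻ z, ‖F z - H z‖ₑ ^ p ∂dV n ν
      ≤ ∫⁻ z, c * (‖F z - G z‖ₑ ^ p + ‖G z - H z‖ₑ ^ p) ∂dV n ν := by
        refine lintegral_mono fun z => ?_
        refine le_trans ?_ (ENNReal.rpow_add_le_mul_rpow_add_rpow _ _ hp)
        gcongr
        calc ‖F z - H z‖ₑ = ‖(F z - G z) + (G z - H z)‖ₑ := by rw [sub_add_sub_cancel]
          _ ≤ _ := enorm_add_le _ _
    _ = c * ((∫⁻ z, ‖F z - G z‖ₑ ^ p ∂dV n ν) + ∫⁻ z, ‖G z - H z‖ₑ ^ p ∂dV n ν) := by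
        rw [lintegral_const_mul' _ _ hct, lintegral_add_left' hm]
    _ < c * (τ / (2 * c) + τ / (2 * c)) :=
        ENNReal.mul_lt_mul_right hc0 hct (ENNReal.add_lt_add h1 h2)
    _ = τ := by
        rw [← two_mul, ← mul_assoc, mul_comm c 2, ENNReal.mul_div_cancel h2c0 h2c]

theorem exists_memA_bounded_close (hn : 2 ≤ n) {p ν : ℝ} (hp : 1 ≤ p)
    (hν : (n : ℝ) / 2 - 1 < ν) {q μ : ℝ} (hq : 1 ≤ q) (hμ : (n : ℝ) / 2 - 1 < μ)
    {F : (Fin n → ℂ) → ℂ} (hF : memA n p ν F) {ε : ℝ} (hε : 0 < ε) :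
    ∃ G, memA n p ν G ∧ memA n q μ G ∧ (∃ M : ℝ, ∀ z ∈ tube n, ‖G z‖ ≤ M) ∧
      lpNorm n p ν (fun z => F z - G z) < ENNReal.ofReal ε := by
  have hp0 : 0 < p := by linarith
  obtain ⟨u, v, hu, hu0, hv, hv0, huv⟩ := exists_lightlike hn
  have hε' : ENNReal.ofReal ε ≠ 0 := by simpa using hε
  obtain ⟨η₁, hη₁, hcomb₁⟩ := exists_lpInt_sub_lt (n := n) hp ν
    (ENNReal.rpow_pos (p := p) hε'.bot_lt ENNReal.ofReal_ne_top)
  obtain ⟨η₂, hη₂, hcomb₂⟩ := exists_lpInt_sub_lt (n := n) hp ν hη₁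
  obtain ⟨δ, hδ, hF₁, hFF₁⟩ := exists_translate_close hp hν hF hu hu0 hη₁
  obtain ⟨δ', hδ', hH, hF₁H⟩ := exists_translate_close hp hν hF₁ hv hv0 hη₂
  have hs : δ • u + δ' • v ∈ cone n := by
    refine ⟨?_, by simp; positivity⟩
    rw [add_comm, lor_add, lor_smul, lor_smul, hu, hv, lorBil_smul_right]
    have : lorBil (δ' • v) u = δ' * lorBil v u := by
      have h := lorBil_sub_smul_left (-δ') 0 v u
      rw [zero_sub, neg_smul, neg_neg, show lorBil 0 u = 0 by simp [lorBil]] at h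
      linarith
    rw [this]
    simp
    positivity
  obtain ⟨C, hC⟩ := exists_norm_translate_le hp hν hF hs
  obtain ⟨G, hG, hGq, hGb, hHG⟩ := exists_damped_close hn hp hH (C := C) (fun z hz => by
    convert hC z hz using 3
    ext i
    simp
    ring) hq hμ hη₂
  refine ⟨G, hG, hGq, hGb, ?_⟩
  have h₂ := hcomb₂ _ _ _ hF₁.1.continuousOn hH.1.continuousOn hF₁H hHG
  have h₁ := hcomb₁ _ _ _ hF.1.continuousOn hF₁.1.continuousOn hFF₁ h₂
  change lpInt n p ν _ ^ (1 / p) < _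
  rw [one_div, ENNReal.rpow_inv_lt_iff hp0]
  exact h₁

/-- Lemma: density of `A^p_ν ∩ A^q_μ` and of `A^p_ν ∩ H^∞` in `A^p_ν`. -/
theorem density_in_Apnu (n : ℕ) [NeZero n] (hn : 3 ≤ n) (p ν : ℝ) (hp : 1 ≤ p)
    (hν : (n : ℝ) / 2 - 1 < ν) :
    (∀ q μ : ℝ, 1 ≤ q → (n : ℝ) / 2 - 1 < μ → ∀ F, memA n p ν F → ∀ ε > (0 : ℝ),
      ∃ G, memA n p ν G ∧ memA n q μ G ∧
        lpNorm n p ν (fun z => F z - G z) < ENNReal.ofReal ε) ∧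
    (∀ F, memA n p ν F → ∀ ε > (0 : ℝ),
      ∃ G, memA n p ν G ∧ DifferentiableOn ℂ G (tube n) ∧
        (∃ M : ℝ, ∀ z ∈ tube n, ‖G z‖ ≤ M) ∧
        lpNorm n p ν (fun z => F z - G z) < ENNReal.ofReal ε) := by
  have hn2 : 2 ≤ n := by omega
  refine ⟨fun q μ hq hμ F hF ε hε => ?_, fun F hF ε hε => ?_⟩
  · obtain ⟨G, hG, hGq, -, hFG⟩ := exists_memA_bounded_close hn2 hp hν hq hμ hF hε
    exact ⟨G, hG, hGq, hFG⟩
  · obtain ⟨G, hG, -, hGb, hFG⟩ := exists_memA_bounded_close hn2 hp hν hp hν hF hε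
    exact ⟨G, hG, hG.1, hGb, hFG⟩
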